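/- arXiv:math/9911079 — 5 statements merged into one kernel-verified Lean document; each statement's English description precedes it below -/
import Mathlib

section
/- Let U ⊆ ℂ^m be open, F : U → ℂ holomorphic, H(z) = (∂²F/∂z^j∂z^k(z)) its complex Hessian, and φ(z) = (z, ∇F(z)). Then for every z ∈ U and all u,v ∈ ℂ^m, γ(Dφ(z)u, Dφ(z)v) = 2·Σ_{j,k} (Im H(z))_{jk} · u^j · conj(v^k). Consequently the pullback Hermitian form φ^*γ is nondegenerate at z if and only if the real symmetric matrix Im H(z) is invertible (this is the nondegeneracy condition on F), and it is positive definite at z if and only if Im H(z) is positive definite. -/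
open Complex ComplexConjugate

/-- The Hermitian form `γ((z,w),(z',w')) = i·Σⱼ (zʲ·conj(w'ⱼ) − conj(z'ʲ)·wⱼ)`
on `V = ℂ^m × ℂ^m` (i.e. `γ(a,b) = i·Ω(a, τb)`). -/
noncomputable def gammaForm (m : ℕ) (a b : (Fin m → ℂ) × (Fin m → ℂ)) : ℂ :=
  I * ∑ j, (a.1 j * conj (b.2 j) - conj (b.1 j) * a.2 j)

/-- The complex Hessian matrix `H(z) = (∂²F/∂zʲ∂zᵏ(z))` of `F` at `z`. -/
noncomputable def cHess (m : ℕ) (F : (Fin m → ℂ) → ℂ) (z : Fin m → ℂ) :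
    Matrix (Fin m) (Fin m) ℂ :=
  Matrix.of fun j k => fderiv ℂ (fun w => fderiv ℂ F w (Pi.single k 1)) z (Pi.single j 1)

section Helpers

open Metric MeasureTheory Filter Topology

theorem aux_fderiv_bound {m : ℕ} {F : (Fin m → ℂ) → ℂ} {z : Fin m → ℂ} {r C : ℝ} (hr : 0 < r)
    (hF : DifferentiableOn ℂ F (ball z (5*r))) (hC : ∀ w ∈ ball z (5*r), ‖F w‖ ≤ C)
    (y : Fin m → ℂ) (hy : y ∈ ball z (3*r)) : ‖fderiv ℂ F y‖ ≤ C / r := by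
  have hC0 : 0 ≤ C := (norm_nonneg _).trans (hC z (mem_ball_self (by linarith)))
  rw [mem_ball, dist_eq_norm] at hy
  refine ContinuousLinearMap.opNorm_le_bound _ (by positivity) fun v => ?_
  by_cases hv : v = 0
  · simp [hv]
  have hv' : 0 < ‖v‖ := norm_pos_iff.2 hv
  have hmem : ∀ t ∈ closedBall (0:ℂ) (r / ‖v‖), y + t • v ∈ ball z (5*r) := by
    intro t ht
    rw [mem_closedBall, dist_zero_right, le_div_iff₀ hv'] at ht
    rw [mem_ball, dist_eq_norm]
    have : y + t • v - z = (y - z) + t • v := by abel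
    rw [this]
    refine (norm_add_le _ _).trans_lt ?_
    rw [norm_smul]; linarith
  have hdl : ∀ t : ℂ, HasFDerivAt (fun t : ℂ => y + t • v) ((1 : ℂ →L[ℂ] ℂ).smulRight v) t := by
    intro t
    exact ((1 : ℂ →L[ℂ] ℂ).smulRight v).hasFDerivAt.const_add y
  have hd : DifferentiableOn ℂ (fun t : ℂ => F (y + t • v)) (closedBall 0 (r / ‖v‖)) := by
    apply hF.comp (t := ball z (5*r)) (fun t _ => (hdl t).differentiableAt.differentiableWithinAt) hmem
  have hk := norm_deriv_le_of_forall_mem_sphere_norm_le (c := (0:ℂ)) (f := fun t : ℂ => F (y + t • v)) (C := C)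
    (div_pos hr hv') (hd.diffContOnCl_ball subset_rfl)
    (fun t ht => hC _ (hmem t (sphere_subset_closedBall ht)))
  have hyb : y ∈ ball z (5*r) := by rw [mem_ball, dist_eq_norm]; linarith
  have hFy : HasFDerivAt F (fderiv ℂ F y) (y + (0:ℂ) • v) := by
    simpa using (hF.differentiableAt (isOpen_ball.mem_nhds hyb)).hasFDerivAt
  have := (HasFDerivAt.comp (0:ℂ) hFy (hdl 0)).hasDerivAt.deriv
  simp only [Function.comp_def] at this
  rw [this] at hk
  simp at hk
  convert hk using 1
  field_simp

theorem aux_diff {m : ℕ} {F : (Fin m → ℂ) → ℂ} {z : Fin m → ℂ} {r C : ℝ} (hr : 0 < r)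
    (hF : DifferentiableOn ℂ F (ball z (5*r))) (hC : ∀ w ∈ ball z (5*r), ‖F w‖ ≤ C)
    (e : Fin m → ℂ) (he : ‖e‖ ≤ 1) : DifferentiableAt ℂ (fun w => fderiv ℂ F w e) z := by
  have hmem : ∀ x ∈ ball z r, ∀ t ∈ ball (0:ℂ) (2*r), x + t • e ∈ ball z (3*r) := by
    intro x hx t ht
    rw [mem_ball, dist_zero_right] at ht
    rw [mem_ball, dist_eq_norm] at hx ⊢
    have : x + t • e - z = (x - z) + t • e := by abel
    rw [this]
    refine (norm_add_le _ _).trans_lt ?_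
    rw [norm_smul]
    have := mul_le_mul_of_nonneg_left he (norm_nonneg t)
    linarith
  have hsub : ball z (3*r) ⊆ ball z (5*r) := ball_subset_ball (by linarith)
  have hdl : ∀ x, ∀ t : ℂ, HasFDerivAt (fun t : ℂ => x + t • e) ((1 : ℂ →L[ℂ] ℂ).smulRight e) t := by
    intro x t
    exact ((1 : ℂ →L[ℂ] ℂ).smulRight e).hasFDerivAt.const_add x
  have hFd : ∀ y ∈ ball z (3*r), HasFDerivAt F (fderiv ℂ F y) y := fun y hy =>
    (hF.differentiableAt (isOpen_ball.mem_nhds (hsub hy))).hasFDerivAt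
  have hcm : ∀ θ, circleMap 0 r θ ∈ ball (0:ℂ) (2*r) := by
    intro θ
    simp [abs_of_pos hr]; linarith
  have key : ∀ x ∈ ball z r, fderiv ℂ F x e =
      (2 * Real.pi * I : ℂ)⁻¹ • ∫ θ in (0:ℝ)..2*Real.pi,
        (deriv (circleMap 0 r) θ * ((circleMap 0 r θ)^2)⁻¹) * F (x + circleMap 0 r θ • e) := by
    intro x hx
    have h1 := two_pi_I_inv_smul_circleIntegral_sub_sq_inv_smul_of_differentiable
      (U := ball (0:ℂ) (2*r)) isOpen_ball (c := 0) (R := r) (w₀ := 0)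
      (closedBall_subset_ball (by linarith)) (f := fun t : ℂ => F (x + t • e))
      (fun t ht => ((hFd _ (hmem x hx t ht)).comp t (hdl x t)).differentiableAt.differentiableWithinAt)
      (mem_ball_self hr)
    have hFy : HasFDerivAt F (fderiv ℂ F x) (x + (0:ℂ) • e) := by
      have := hFd _ (hmem x hx 0 (mem_ball_self (by linarith)))
      simpa using this
    have h2 := (HasFDerivAt.comp (0:ℂ) hFy (hdl x 0)).hasDerivAt.deriv
    simp only [Function.comp_def] at h2
    rw [h2] at h1
    simp only [circleIntegral, sub_zero, smul_eq_mul] at h1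
    simp only [smul_eq_mul, mul_assoc] at h1 ⊢
    rw [h1]; simp
  set g : ℝ → ℂ := fun θ => deriv (circleMap 0 r) θ * ((circleMap 0 r θ)^2)⁻¹ with hg
  have hgc : Continuous g := by
    have : ∀ θ, circleMap 0 r θ ^ 2 ≠ 0 := fun θ => pow_ne_zero _ (circleMap_ne_center hr.ne')
    have h2 : Continuous (circleMap 0 r) := continuous_circleMap 0 r
    simp only [hg, deriv_circleMap]
    exact (h2.mul continuous_const).mul ((h2.pow 2).inv₀ this)
  have hcont : ∀ x ∈ ball z r, Continuous fun θ => g θ * F (x + circleMap 0 r θ • e) := by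
    intro x hx
    refine hgc.mul ?_
    have h2 : Continuous (circleMap 0 r) := continuous_circleMap 0 r
    exact hF.continuousOn.comp_continuous (continuous_const.add (h2.smul continuous_const))
      (fun θ => hsub (hmem x hx _ (hcm θ)))
  have hI := intervalIntegral.hasFDerivAt_integral_of_dominated_of_fderiv_le (𝕜 := ℂ) (μ := volume)
    (a := 0) (b := 2*Real.pi) (F := fun x θ => g θ * F (x + circleMap 0 r θ • e))
    (F' := fun x θ => g θ • fderiv ℂ F (x + circleMap 0 r θ • e)) (x₀ := z)
    (bound := fun θ => ‖g θ‖ * (C / r)) (ball_mem_nhds z hr)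
    (by
      filter_upwards [ball_mem_nhds z hr] with x hx
      exact (hcont x hx).aestronglyMeasurable)
    ((hcont z (mem_ball_self hr)).intervalIntegrable _ _)
    (by
      have h2 : Continuous (circleMap 0 r) := continuous_circleMap 0 r
      have h3 : Measurable fun θ => fderiv ℂ F (z + circleMap 0 r θ • e) :=
        (measurable_fderiv ℂ F).comp (continuous_const.add (h2.smul continuous_const)).measurable
      exact hgc.aestronglyMeasurable.smul h3.aestronglyMeasurable)
    (by
      refine Eventually.of_forall fun θ _ x hx => ?_
      rw [norm_smul]
      exact mul_le_mul_of_nonneg_left (aux_fderiv_bound hr hF hC _ (hmem x hx _ (hcm θ)))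
        (norm_nonneg _))
    ((hgc.norm.mul continuous_const).intervalIntegrable _ _)
    (by
      refine Eventually.of_forall fun θ _ x hx => ?_
      have h1 := (hFd _ (hmem x hx _ (hcm θ))).comp x ((hasFDerivAt_id x).add_const (circleMap 0 r θ • e))
      exact h1.const_mul (g θ))
  refine (hI.differentiableAt.const_smul (2 * Real.pi * I : ℂ)⁻¹).congr_of_eventuallyEq ?_
  filter_upwards [ball_mem_nhds z hr] with x hx
  exact key x hx

theorem aux_symm {m : ℕ} {U : Set (Fin m → ℂ)} (hU : IsOpen U)
    {F : (Fin m → ℂ) → ℂ} (hF : DifferentiableOn ℂ F U) {z : Fin m → ℂ} (hz : z ∈ U) (j k : Fin m) :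
    fderiv ℂ (fun w => fderiv ℂ F w (Pi.single k 1)) z (Pi.single j 1) =
    fderiv ℂ (fun w => fderiv ℂ F w (Pi.single j 1)) z (Pi.single k 1) := by
  have hc : ContinuousAt F z := (hF.differentiableAt (hU.mem_nhds hz)).continuousAt
  have hb : ∀ᶠ w in 𝓝 z, ‖F w‖ < ‖F z‖ + 1 := hc.norm.eventually_lt continuousAt_const (by linarith)
  obtain ⟨ε, hε, hball⟩ := Metric.mem_nhds_iff.1 (Filter.inter_mem hb (hU.mem_nhds hz))
  have hr : 0 < ε / 5 := by positivity
  have h5 : 5 * (ε / 5) = ε := by ring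
  have hp : ∀ i, DifferentiableAt ℂ (fun w => fderiv ℂ F w (Pi.single i 1)) z := by
    intro i
    refine aux_diff (C := ‖F z‖ + 1) hr ?_ ?_ _ ?_
    · rw [h5]; exact hF.mono fun w hw => (hball hw).2
    · rw [h5]; exact fun w hw => (hball hw).1.le
    · refine (pi_norm_le_iff_of_nonneg zero_le_one).2 fun l => ?_
      rw [Pi.single_apply]
      split_ifs <;> simp
  have hd : DifferentiableAt ℂ (fderiv ℂ F) z := by
    have : fderiv ℂ F = fun w => ∑ i, (fderiv ℂ F w (Pi.single i 1)) •
        (ContinuousLinearMap.proj i : (Fin m → ℂ) →L[ℂ] ℂ) := by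
      ext w v
      conv_lhs => rw [pi_eq_sum_univ' v]
      simp only [map_sum, map_smul, ContinuousLinearMap.sum_apply, ContinuousLinearMap.smul_apply,
        ContinuousLinearMap.proj_apply, smul_eq_mul]
      exact Finset.sum_congr rfl fun i _ => mul_comm _ _
    rw [this]
    exact DifferentiableAt.fun_sum fun i _ => (hp i).smul_const _
  have hs := second_derivative_symmetric_of_eventually (f := F) (f' := fderiv ℂ F)
    (by filter_upwards [hU.mem_nhds hz] with y hy
        exact (hF.differentiableAt (hU.mem_nhds hy)).hasFDerivAt) hd.hasFDerivAt
    (Pi.single j 1) (Pi.single k 1)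
  have h : ∀ v u, fderiv ℂ (fun w => fderiv ℂ F w v) z u = fderiv ℂ (fderiv ℂ F) z u v := by
    intro v u
    rw [fderiv_clm_apply hd (differentiableAt_const v)]
    simp
  rw [h, h, hs]

theorem aux_lin {m : ℕ} (H : Matrix (Fin m) (Fin m) ℂ) (hsym : ∀ j k, H j k = H k j) :
      (∀ u v : Fin m → ℂ,
        gammaForm m (u, H.mulVec u) (v, H.mulVec v)
          = 2 * ∑ j, ∑ k, ((H j k).im : ℂ) * u j * conj (v k)) ∧
      ((∀ u : Fin m → ℂ,
          (∀ v : Fin m → ℂ,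
            gammaForm m (u, H.mulVec u) (v, H.mulVec v) = 0)
          → u = 0)
        ↔ IsUnit (Matrix.of fun j k => (H j k).im : Matrix (Fin m) (Fin m) ℝ)) ∧
      ((∀ u : Fin m → ℂ, u ≠ 0 →
          0 < (gammaForm m (u, H.mulVec u) (u, H.mulVec u)).re)
        ↔ (Matrix.of fun j k => (H j k).im : Matrix (Fin m) (Fin m) ℝ).PosDef) := by
  have h1 : ∀ u v : Fin m → ℂ,
        gammaForm m (u, H.mulVec u) (v, H.mulVec v)
          = 2 * ∑ j, ∑ k, ((H j k).im : ℂ) * u j * conj (v k) := by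
    intro u v
    have e1 : ∑ j, conj (v j) * H.mulVec u j = ∑ j, ∑ k, H j k * u j * conj (v k) := by
      rw [Finset.sum_comm]
      refine Finset.sum_congr rfl fun j _ => ?_
      simp only [Matrix.mulVec, dotProduct, Finset.mul_sum]
      refine Finset.sum_congr rfl fun k _ => ?_
      rw [hsym j k]; ring
    have e2 : ∑ j, u j * conj (H.mulVec v j) = ∑ j, ∑ k, conj (H j k) * u j * conj (v k) := by
      refine Finset.sum_congr rfl fun j _ => ?_
      simp only [Matrix.mulVec, dotProduct, Finset.mul_sum, map_sum, map_mul]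
      refine Finset.sum_congr rfl fun k _ => ?_
      ring
    simp only [gammaForm]
    rw [Finset.sum_sub_distrib, e1, e2, ← Finset.sum_sub_distrib]
    simp only [← Finset.sum_sub_distrib, Finset.mul_sum]
    refine Finset.sum_congr rfl fun j _ => Finset.sum_congr rfl fun k _ => ?_
    have e3 : H j k - conj (H j k) = (2 * (H j k).im : ℝ) * I := Complex.sub_conj _
    have e4 : conj (H j k) = H j k - (2 * (H j k).im : ℝ) * I := by rw [← e3]; ring
    rw [e4]
    push_cast
    linear_combination (-2 * ((H j k).im : ℂ) * u j * conj (v k)) * Complex.I_mul_I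
  refine ⟨h1, ?_, ?_⟩
  · rw [← Matrix.mulVec_injective_iff_isUnit]
    constructor
    · intro h
      refine (injective_iff_map_eq_zero
        (Matrix.mulVecLin (Matrix.of fun j k => (H j k).im))).2 fun x hx => ?_
      have hx' : ∀ k, ∑ j, (H j k).im * x j = 0 := by
        intro k
        have := congrFun hx k
        simp only [Matrix.mulVecLin_apply, Matrix.mulVec, dotProduct, Matrix.of_apply,
          Pi.zero_apply] at this
        rw [← this]
        exact Finset.sum_congr rfl fun j _ => by rw [hsym j k]
      have := h (fun j => (x j : ℂ)) (fun v => by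
        rw [h1, Finset.sum_comm]
        simp only [← Finset.sum_mul]
        have hx2 : ∀ k, ∑ j, ((H j k).im : ℂ) * (x j : ℂ) = 0 := fun k => by
          exact_mod_cast hx' k
        simp [hx2])
      ext j
      simpa using congrFun this j
    · intro hinj u hu
      have hk : ∀ k, ∑ j, ((H k j).im : ℂ) * u j = 0 := by
        intro k
        have := hu (Pi.single k 1)
        rw [h1] at this
        simp only [Pi.single_apply, apply_ite conj, map_one, map_zero, mul_ite, mul_one, mul_zero,
          Finset.sum_ite_eq', Finset.mem_univ, if_true] at this
        simpa [hsym k] using this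
      have hre : (fun j => (u j).re) = 0 := by
        apply hinj
        ext k
        have := congrArg Complex.re (hk k)
        simpa [Matrix.mulVec, dotProduct] using this
      have him : (fun j => (u j).im) = 0 := by
        apply hinj
        ext k
        have := congrArg Complex.im (hk k)
        simpa [Matrix.mulVec, dotProduct] using this
      ext j
      exact Complex.ext (congrFun hre j) (congrFun him j)
  · have h2 : ∀ u : Fin m → ℂ, (gammaForm m (u, H.mulVec u) (u, H.mulVec u)).re =
        2 * (star (fun j => (u j).re) ⬝ᵥ
            ((Matrix.of fun j k => (H j k).im : Matrix (Fin m) (Fin m) ℝ).mulVec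
              (fun j => (u j).re)) +
          star (fun j => (u j).im) ⬝ᵥ
            ((Matrix.of fun j k => (H j k).im : Matrix (Fin m) (Fin m) ℝ).mulVec
              (fun j => (u j).im))) := by
      intro u
      rw [h1]
      simp only [Matrix.mulVec, dotProduct, Finset.mul_sum, ← Finset.sum_add_distrib,
        Complex.re_sum, Matrix.of_apply, Pi.star_apply, star_trivial]
      refine Finset.sum_congr rfl fun j _ => Finset.sum_congr rfl fun k _ => ?_
      simp
      ring
    constructor
    · intro h
      refine Matrix.PosDef.of_dotProduct_mulVec_pos ?_ fun x hx => ?_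
      · ext j k
        simp [hsym j k]
      · have := h (fun j => (x j : ℂ)) (fun h0 => hx (by
          ext j
          simpa using congrFun h0 j))
        rw [h2] at this
        simp only [Complex.ofReal_re, Complex.ofReal_im] at this
        have h0 : (fun _ : Fin m => (0:ℝ)) = 0 := rfl
        rw [h0] at this
        simpa using this
    · intro h u hu
      rw [h2]
      have hps := h.posSemidef
      have ha := hps.dotProduct_mulVec_nonneg (fun j => (u j).re)
      have hb := hps.dotProduct_mulVec_nonneg (fun j => (u j).im)
      by_cases hre : (fun j => (u j).re) = 0
      · have him : (fun j => (u j).im) ≠ 0 := fun him => hu (by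
          ext j
          exact Complex.ext (congrFun hre j) (congrFun him j))
        have := h.dotProduct_mulVec_pos him
        linarith
      · have := h.dotProduct_mulVec_pos hre
        linarith

end Helpers

/-- For `F` holomorphic on an open `U ⊆ ℂ^m` and `φ(z) = (z, ∇F(z))` with
`Dφ(z)u = (u, H(z)u)`, one has
`γ(Dφ(z)u, Dφ(z)v) = 2·Σⱼₖ (Im H(z))ⱼₖ · uʲ · conj(vᵏ)`.
Consequently `φ*γ` is nondegenerate at `z` iff the real symmetric matrix `Im H(z)`
is invertible, and positive definite at `z` iff `Im H(z)` is positive definite. -/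
theorem pullback_gamma_eq_im_hessian (m : ℕ) (U : Set (Fin m → ℂ)) (hU : IsOpen U)
    (F : (Fin m → ℂ) → ℂ) (hF : DifferentiableOn ℂ F U) :
    ∀ z ∈ U,
      (∀ u v : Fin m → ℂ,
        gammaForm m (u, (cHess m F z).mulVec u) (v, (cHess m F z).mulVec v)
          = 2 * ∑ j, ∑ k, ((cHess m F z j k).im : ℂ) * u j * conj (v k)) ∧
      ((∀ u : Fin m → ℂ,
          (∀ v : Fin m → ℂ,
            gammaForm m (u, (cHess m F z).mulVec u) (v, (cHess m F z).mulVec v) = 0)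
          → u = 0)
        ↔ IsUnit (Matrix.of fun j k => (cHess m F z j k).im : Matrix (Fin m) (Fin m) ℝ)) ∧
      ((∀ u : Fin m → ℂ, u ≠ 0 →
          0 < (gammaForm m (u, (cHess m F z).mulVec u) (u, (cHess m F z).mulVec u)).re)
        ↔ (Matrix.of fun j k => (cHess m F z j k).im : Matrix (Fin m) (Fin m) ℝ).PosDef) := by
  intro z hz
  have hsym : ∀ j k, cHess m F z j k = cHess m F z k j := fun j k => by
    simpa [cHess] using aux_symm hU hF hz j k
  exact aux_lin (cHess m F z) hsym
end

section
/- Let U ⊆ ℂ^m be open, F : U → ℂ holomorphic with complex Hessian H(z), and define the real map ψ : U → ℝ^m × ℝ^m by ψ(z) = (Re z, Re ∇F(z)). Write real vectors u = a + i·b, v = c + i·d with a,b,c,d ∈ ℝ^m, so that the real derivative is Dψ(z)u = (a, Re(H(z)u)). Then for all z ∈ U and u,v ∈ ℂ^m, Im(γ(Dφ(z)u, Dφ(z)v)) = 2·σ(Dψ(z)u, Dψ(z)v), where σ((a,p),(c,q)) = Σ_{j=1}^m (a^j q_j − c^j p_j) is the constant standard symplectic form on ℝ^{2m}. In particular, the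 Kähler 2-form of the induced metric is the pullback under the flat coordinate map ψ of a constant 2-form, hence is parallel for the induced flat connection. -/
open Complex ComplexConjugate

/-- The constant standard symplectic form `σ((a,p),(c,q)) = Σⱼ (aʲ·qⱼ − cʲ·pⱼ)`
on `ℝ^m × ℝ^m = ℝ^{2m}`. -/
def sigmaForm (m : ℕ) (x y : (Fin m → ℝ) × (Fin m → ℝ)) : ℝ :=
  ∑ j, (x.1 j * y.2 j - y.1 j * x.2 j)

/-- Each directional derivative of a holomorphic function of several variables is holomorphic
(differentiate Cauchy's integral formula under the integral sign). -/
theorem differentiableAt_fderiv_apply_aux (m : ℕ) (U : Set (Fin m → ℂ)) (hU : IsOpen U)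
    (F : (Fin m → ℂ) → ℂ) (hF : DifferentiableOn ℂ F U) (z : Fin m → ℂ) (hz : z ∈ U)
    (e : Fin m → ℂ) (he : ‖e‖ ≤ 1) :
    DifferentiableAt ℂ (fun w => fderiv ℂ F w e) z := by
  have hc : ContinuousAt F z := (hF.differentiableAt (hU.mem_nhds hz)).continuousAt
  have hn : U ∩ F ⁻¹' (Metric.ball (F z) 1) ∈ nhds z :=
    Filter.inter_mem (hU.mem_nhds hz) (hc (Metric.ball_mem_nhds _ one_pos))
  obtain ⟨ε, hε, hball⟩ := Metric.mem_nhds_iff.1 hn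
  obtain ⟨R, hR, hRε⟩ : ∃ R : ℝ, 0 < R ∧ 4 * R = ε := ⟨ε / 4, by linarith, by ring⟩
  subst hRε
  have hdiff : ∀ w ∈ Metric.ball z (4 * R), DifferentiableAt ℂ F w := fun w hw =>
    hF.differentiableAt (hU.mem_nhds (hball hw).1)
  have hbd : ∀ w ∈ Metric.ball z (3 * R), ‖fderiv ℂ F w‖ ≤ 2 / R := by
    intro w hw
    have hsub : Metric.ball w R ⊆ Metric.ball z (4 * R) := by
      apply Metric.ball_subset_ball'
      have := Metric.mem_ball.1 hw
      linarith
    apply Complex.norm_fderiv_le_div_of_mapsTo_ball _ _ hR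
    · exact fun x hx => (hdiff x (hsub hx)).differentiableWithinAt
    · intro x hx
      have h1 := Metric.mem_ball.1 (hball (hsub hx)).2
      have h2 := Metric.mem_ball.1 (hball (hsub (Metric.mem_ball_self hR))).2
      have h3 := dist_triangle_right (F x) (F w) (F z)
      rw [Metric.mem_closedBall]
      linarith
  have hmem : ∀ w ∈ Metric.ball z R, ∀ t : ℂ, ‖t‖ ≤ R → w + t • e ∈ Metric.ball z (3 * R) := by
    intro w hw t ht
    have h1 := Metric.mem_ball.1 hw
    rw [dist_eq_norm] at h1
    rw [Metric.mem_ball, dist_eq_norm]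
    have h2 : ‖t • e‖ ≤ R := by
      rw [norm_smul]
      calc ‖t‖ * ‖e‖ ≤ R * 1 := by gcongr
        _ = R := mul_one R
    calc ‖w + t • e - z‖ = ‖(w - z) + t • e‖ := by congr 1; abel
      _ ≤ ‖w - z‖ + ‖t • e‖ := norm_add_le _ _
      _ < 3 * R := by linarith
  have hsub34 : Metric.ball z (3 * R) ⊆ Metric.ball z (4 * R) :=
    Metric.ball_subset_ball (by linarith)
  have hcm : ∀ θ : ℝ, ‖circleMap 0 R θ‖ ≤ R := fun θ => by
    simp [abs_of_pos hR]
  let c : ℝ → ℂ := fun θ => deriv (circleMap 0 R) θ * ((circleMap 0 R θ - 0) ^ 2)⁻¹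
  have hcont_c : Continuous c := by
    have h0 : ∀ θ, (circleMap 0 R θ - 0) ^ 2 ≠ 0 := fun θ => by
      simp [circleMap_eq_center_iff, hR.ne']
    have h1 : Continuous (fun θ => ((circleMap 0 R θ - 0) ^ 2)⁻¹) :=
      Continuous.inv₀ (by fun_prop) h0
    have h2 : Continuous (deriv (circleMap 0 R)) := by
      have : deriv (circleMap 0 R) = fun θ => circleMap 0 R θ * I := by
        ext θ; simp
      rw [this]
      fun_prop
    exact h2.mul h1
  have hcnorm : ∀ θ, ‖c θ‖ ≤ 1 / R := by
    intro θ
    simp only [c, norm_mul, norm_inv, norm_pow, deriv_circleMap, sub_zero, norm_circleMap_zero,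
      Complex.norm_I, abs_of_pos hR]
    apply le_of_eq
    field_simp
  have hcontF : ∀ w ∈ Metric.ball z R, Continuous (fun θ => F (w + circleMap 0 R θ • e)) := by
    intro w hw
    rw [continuous_iff_continuousAt]
    intro θ
    have h1 := (hdiff _ (hsub34 (hmem w hw _ (hcm θ)))).continuousAt
    have h2 : ContinuousAt (fun θ => w + circleMap 0 R θ • e) θ := by fun_prop
    exact ContinuousAt.comp (f := fun θ => w + circleMap 0 R θ • e) h1 h2
  have hrepr : ∀ w ∈ Metric.ball z R, fderiv ℂ F w e =
      (2 * Real.pi * I : ℂ)⁻¹ • ∫ θ in (0 : ℝ)..2 * Real.pi,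
        c θ * F (w + circleMap 0 R θ • e) := by
    intro w hw
    have hopen : IsOpen ((fun t : ℂ => w + t • e) ⁻¹' Metric.ball z (4 * R)) :=
      Metric.isOpen_ball.preimage (by fun_prop)
    have hC := two_pi_I_inv_smul_circleIntegral_sub_sq_inv_smul_of_differentiable hopen
      (c := 0) (w₀ := 0) (R := R) (f := fun t : ℂ => F (w + t • e))
      (fun t ht => hsub34 (hmem w hw t (by simpa using ht)))
      (fun t ht => ((hdiff _ ht).comp (f := fun t : ℂ => w + t • e) t
        (by fun_prop)).differentiableWithinAt)
      (Metric.mem_ball_self hR)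
    have hd : HasDerivAt (fun t : ℂ => F (w + t • e)) (fderiv ℂ F w e) 0 := by
      have h1 : HasFDerivAt F (fderiv ℂ F w) (w + (0 : ℂ) • e) := by
        have := (hdiff w (Metric.ball_subset_ball (by linarith) hw)).hasFDerivAt
        simpa using this
      have h2 : HasDerivAt (fun t : ℂ => w + t • e) e 0 := by
        simpa using ((hasDerivAt_id (0 : ℂ)).smul_const e).const_add w
      exact h1.comp_hasDerivAt (f := fun t : ℂ => w + t • e) 0 h2
    rw [hd.deriv] at hC
    rw [← hC]
    simp only [circleIntegral, c, smul_eq_mul, mul_assoc]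
  have key := intervalIntegral.hasFDerivAt_integral_of_dominated_of_fderiv_le
    (𝕜 := ℂ) (μ := MeasureTheory.volume) (a := 0) (b := 2 * Real.pi)
    (F := fun w θ => c θ * F (w + circleMap 0 R θ • e))
    (F' := fun w θ => c θ • fderiv ℂ F (w + circleMap 0 R θ • e))
    (bound := fun _ => 1 / R * (2 / R)) (x₀ := z)
    (Metric.ball_mem_nhds z hR) ?_ ?_ ?_ ?_ ?_ ?_
  · have heq : (fun w => fderiv ℂ F w e) =ᶠ[nhds z] fun w =>
        (2 * Real.pi * I : ℂ)⁻¹ • ∫ θ in (0 : ℝ)..2 * Real.pi,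
          c θ * F (w + circleMap 0 R θ • e) :=
      Filter.eventually_of_mem (Metric.ball_mem_nhds z hR) hrepr
    exact (key.differentiableAt.fun_const_smul _).congr_of_eventuallyEq heq
  · filter_upwards [Metric.ball_mem_nhds z hR] with w hw
    exact (hcont_c.mul (hcontF w hw)).aestronglyMeasurable
  · exact (hcont_c.mul (hcontF z (Metric.mem_ball_self hR))).intervalIntegrable _ _
  · apply Measurable.aestronglyMeasurable
    apply hcont_c.measurable.smul
    refine (measurable_fderiv ℂ F).comp (Continuous.measurable ?_)
    fun_prop
  · refine Filter.Eventually.of_forall fun θ _ w hw => ?_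
    rw [norm_smul]
    exact mul_le_mul (hcnorm θ) (hbd _ (hmem w hw _ (hcm θ))) (norm_nonneg _) (by positivity)
  · exact intervalIntegrable_const
  · refine Filter.Eventually.of_forall fun θ _ w hw => ?_
    have h1 := (hdiff _ (hsub34 (hmem w hw _ (hcm θ)))).hasFDerivAt
    have h2 : HasFDerivAt (fun w => F (w + circleMap 0 R θ • e))
        (fderiv ℂ F (w + circleMap 0 R θ • e)) w := by
      exact (hasFDerivAt_comp_add_right _).2 h1
    exact h2.const_mul (c θ)

/-- The complex Hessian of a holomorphic function is symmetric. -/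
theorem cHess_symm_aux (m : ℕ) (U : Set (Fin m → ℂ)) (hU : IsOpen U)
    (F : (Fin m → ℂ) → ℂ) (hF : DifferentiableOn ℂ F U) (z : Fin m → ℂ) (hz : z ∈ U)
    (j k : Fin m) : cHess m F z j k = cHess m F z k j := by
  have hD : ∀ k : Fin m, DifferentiableAt ℂ (fun w => fderiv ℂ F w (Pi.single k 1)) z := fun k =>
    differentiableAt_fderiv_apply_aux m U hU F hF z hz _ (by simp [Pi.norm_single])
  have hrep : fderiv ℂ F = fun w => ∑ k : Fin m, (fderiv ℂ F w (Pi.single k 1)) •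
      (ContinuousLinearMap.proj k : (Fin m → ℂ) →L[ℂ] ℂ) := by
    ext w x
    conv_lhs => rw [← Finset.univ_sum_single x]
    rw [map_sum, ContinuousLinearMap.sum_apply]
    refine Finset.sum_congr rfl fun k _ => ?_
    have : (Pi.single k (x k) : Fin m → ℂ) = x k • Pi.single k 1 := by
      rw [← Pi.single_smul]; simp
    rw [this, map_smul]
    simp [mul_comm]
  have hDD : DifferentiableAt ℂ (fderiv ℂ F) z := by
    rw [hrep]
    exact DifferentiableAt.fun_sum fun k _ => (hD k).smul_const _
  have hsym := second_derivative_symmetric_of_eventually (𝕜 := ℂ) (f := F) (f' := fderiv ℂ F)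
    (Filter.eventually_of_mem (hU.mem_nhds hz)
      fun y hy => (hF.differentiableAt (hU.mem_nhds hy)).hasFDerivAt) hDD.hasFDerivAt
  have hval : ∀ j k, cHess m F z j k =
      fderiv ℂ (fderiv ℂ F) z (Pi.single j 1) (Pi.single k 1) := by
    intro j k
    have h := hDD.hasFDerivAt.clm_apply (hasFDerivAt_const (Pi.single k (1 : ℂ)) z)
    simp only [cHess, Matrix.of_apply]
    rw [h.fderiv]
    simp
  rw [hval, hval, hsym]

/-- For `F` holomorphic on an open `U ⊆ ℂ^m`, `φ(z) = (z, ∇F(z))`,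
`Dφ(z)u = (u, H(z)u)`, and the real map `ψ(z) = (Re z, Re ∇F(z))` with real derivative
`Dψ(z)u = (Re u, Re(H(z)u))`, one has
`Im(γ(Dφ(z)u, Dφ(z)v)) = 2·σ(Dψ(z)u, Dψ(z)v)`:
the Kähler form of the induced metric is the pullback of the constant symplectic
form `σ` under the flat coordinate map `ψ`. -/
theorem im_gamma_eq_pullback_sigma (m : ℕ) (U : Set (Fin m → ℂ)) (hU : IsOpen U)
    (F : (Fin m → ℂ) → ℂ) (hF : DifferentiableOn ℂ F U) :
    ∀ z ∈ U, ∀ u v : Fin m → ℂ,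
      (gammaForm m (u, (cHess m F z).mulVec u) (v, (cHess m F z).mulVec v)).im
        = 2 * sigmaForm m
            (fun j => (u j).re, fun j => ((cHess m F z).mulVec u j).re)
            (fun j => (v j).re, fun j => ((cHess m F z).mulVec v j).re) := by
  intro z hz u v
  have hsymm : (cHess m F z).transpose = cHess m F z := by
    ext j k
    exact cHess_symm_aux m U hU F hF z hz k j
  set H := cHess m F z
  have hdot : ∑ j, u j * H.mulVec v j = ∑ j, v j * H.mulVec u j := by
    change u ⬝ᵥ H.mulVec v = v ⬝ᵥ H.mulVec u
    rw [Matrix.dotProduct_mulVec, ← Matrix.mulVec_transpose, hsymm, dotProduct_comm]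
  have hre := congrArg Complex.re hdot
  simp only [Complex.re_sum, Complex.mul_re, Finset.sum_sub_distrib] at hre
  simp only [gammaForm, sigmaForm, Complex.I_mul_im, Complex.re_sum, Complex.sub_re,
    Complex.mul_re, Complex.conj_re, Complex.conj_im, Finset.sum_sub_distrib, mul_neg, neg_mul,
    sub_neg_eq_add, Finset.sum_add_distrib, Finset.sum_neg_distrib]
  linarith
end

section
/- Let U ⊆ ℝ^n be open, let ω be a constant (x-independent) alternating bilinear form on ℝ^n, and let J : U → End(ℝ^n) be a differentiable map with J(x)∘J(x) = −id and ω(J(x)u, J(x)v) = ω(u,v) for all x ∈ U, u,v ∈ ℝ^n. Define g(x)(u,v) = ω(u, J(x)v). Then g(x) is a symmetric bilinear form, and for all x ∈ U and u,v,w ∈ ℝ^n, the directional derivative of g satisfies (D_u g)(x)(v,w) = g(x)(v, −J(x)((D_u J)(x)w)); that is, the conjugate connection of the standard flat connection D with respect to g is the connection ∇^J = J ∘ D ∘ J^{−1}, whose Christoffel term on constant fields is ∇^J_u w = −J(x)((D_u J)(x)w). -/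
/-- Let `U ⊆ ℝ^n` be open, `ω` a constant alternating bilinear form on `ℝ^n`, and
`J : U → End(ℝ^n)` differentiable with `J² = −id` and `ω(Ju, Jv) = ω(u,v)` on `U`.
Then `g(x)(u,v) := ω(u, J(x)v)` is symmetric, and
`(D_u g)(x)(v,w) = g(x)(v, −J(x)((D_u J)(x)w))`; i.e. the `g`-conjugate connection
of the flat connection `D` is `∇ᴶ = J ∘ D ∘ J⁻¹`, with Christoffel term
`∇ᴶ_u w = −J(x)((D_u J)(x)w)` on constant fields. -/
theorem conjugate_connection_eq_JDJ (n : ℕ) (U : Set (Fin n → ℝ)) (hU : IsOpen U)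
    (ω : (Fin n → ℝ) →ₗ[ℝ] (Fin n → ℝ) →ₗ[ℝ] ℝ)
    (hωalt : ∀ u v : Fin n → ℝ, ω u v = - ω v u)
    (J : (Fin n → ℝ) → ((Fin n → ℝ) →L[ℝ] (Fin n → ℝ)))
    (hJdiff : DifferentiableOn ℝ J U)
    (hJ2 : ∀ x ∈ U, ∀ v : Fin n → ℝ, J x (J x v) = -v)
    (hJω : ∀ x ∈ U, ∀ u v : Fin n → ℝ, ω (J x u) (J x v) = ω u v) :
    (∀ x ∈ U, ∀ u v : Fin n → ℝ, ω u (J x v) = ω v (J x u)) ∧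
    (∀ x ∈ U, ∀ u v w : Fin n → ℝ,
      fderiv ℝ (fun y => ω v (J y w)) x u
        = ω v (J x (-(J x ((fderiv ℝ J x u) w))))) := by
  refine ⟨fun x hx u v => ?_, fun x hx u v w => ?_⟩
  · rw [← hJω x hx u (J x v), hJ2 x hx v, map_neg, hωalt v (J x u)]
  · have hJx : HasFDerivAt J (fderiv ℝ J x) x :=
      (hJdiff.differentiableAt (hU.mem_nhds hx)).hasFDerivAt
    have h1 : HasFDerivAt (fun y => J y w)
        ((ContinuousLinearMap.apply ℝ (Fin n → ℝ) w).comp (fderiv ℝ J x)) x :=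
      (ContinuousLinearMap.apply ℝ (Fin n → ℝ) w).hasFDerivAt.comp x hJx
    have h2 : HasFDerivAt (fun y => ω v (J y w))
        ((LinearMap.toContinuousLinearMap (ω v)).comp
          ((ContinuousLinearMap.apply ℝ (Fin n → ℝ) w).comp (fderiv ℝ J x))) x :=
      (LinearMap.toContinuousLinearMap (ω v)).hasFDerivAt.comp x h1
    rw [h2.fderiv, map_neg (J x), hJ2 x hx, neg_neg]
    rfl
end

section
/- Let U ⊆ ℝ^n be open and J : U → End(ℝ^n) a differentiable map with J(x)∘J(x) = −id for all x ∈ U, and suppose the derivative of J is symmetric: (D_u J)(x)v = (D_v J)(x)u for all x ∈ U, u,v ∈ ℝ^n. Then the Nijenhuis tensor of J vanishes: for all x ∈ U and u,v ∈ ℝ^n, N(x)(u,v) := (D_{J(x)u} J)(x)v − (D_{J(x)v} J)(x)u − J(x)((D_u J)(x)v) + J(x)((D_v J)(x)u) = 0. (Hence, by the Newlander–Nirenberg theorem, the almost complex structure J is integrable whenever both the flat connection D and ∇^J = JDJ^{−1} are torsionfree.) -/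
/-- Let `U ⊆ ℝ^n` be open and `J : U → End(ℝ^n)` differentiable with `J² = −id`
on `U`, and suppose the derivative of `J` is symmetric:
`(D_u J)(x)v = (D_v J)(x)u` for all `x ∈ U`, `u, v`. Then the Nijenhuis tensor of
`J` vanishes:
`N(x)(u,v) = (D_{J(x)u} J)(x)v − (D_{J(x)v} J)(x)u − J(x)((D_u J)(x)v) + J(x)((D_v J)(x)u) = 0`
for all `x ∈ U`, `u, v ∈ ℝ^n`. (Hence, by Newlander–Nirenberg, `J` is integrable
whenever both `D` and `∇ᴶ = JDJ⁻¹` are torsionfree.) -/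
theorem nijenhuis_vanishes_of_dJ_symm (n : ℕ) (U : Set (Fin n → ℝ)) (hU : IsOpen U)
    (J : (Fin n → ℝ) → ((Fin n → ℝ) →L[ℝ] (Fin n → ℝ)))
    (hJdiff : DifferentiableOn ℝ J U)
    (hJ2 : ∀ x ∈ U, ∀ v : Fin n → ℝ, J x (J x v) = -v)
    (hsymm : ∀ x ∈ U, ∀ u v : Fin n → ℝ,
      (fderiv ℝ J x u) v = (fderiv ℝ J x v) u) :
    ∀ x ∈ U, ∀ u v : Fin n → ℝ,
      (fderiv ℝ J x (J x u)) v - (fderiv ℝ J x (J x v)) u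
        - J x ((fderiv ℝ J x u) v) + J x ((fderiv ℝ J x v) u) = 0 := by
  intro x hx u v
  have hd : HasFDerivAt J (fderiv ℝ J x) x :=
    (hJdiff.differentiableAt (hU.mem_nhds hx)).hasFDerivAt
  have key : ∀ w z : Fin n → ℝ,
      (fderiv ℝ J x w) (J x z) = -J x ((fderiv ℝ J x w) z) := by
    intro w z
    have h1 := hd.clm_apply (hd.clm_apply (hasFDerivAt_const z x))
    have h2 : HasFDerivAt (fun y => J y (J y z)) (0 : (Fin n → ℝ) →L[ℝ] (Fin n → ℝ)) x := by
      refine (hasFDerivAt_const (-z) x).congr_of_eventuallyEq ?_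
      filter_upwards [hU.mem_nhds hx] with y hy
      exact hJ2 y hy z
    have h3 := congrArg (fun L => L w) (h1.unique h2)
    simp at h3
    rw [add_comm] at h3
    exact eq_neg_of_add_eq_zero_left h3
  rw [hsymm x hx (J x u) v, hsymm x hx (J x v) u, key, key]
  abel
end

section
/- (Calabi–Pogorelov / Jörgens theorem, graph form.) Let u : ℝ^n → ℝ be a smooth function whose Hessian is positive definite at every point and satisfies det(Hess u(x)) = 1 for all x ∈ ℝ^n. Then u is a quadratic polynomial: there exist a positive definite symmetric matrix A with det A = 1, a vector b ∈ ℝ^n, and c ∈ ℝ such that u(x) = (1/2)·xᵀAx + bᵀx + c for all x. Equivalently, the graph of u in ℝ^{n+1} is affinely congruent to the paraboloid x^{n+1} = Σ_{i=1}^n (x^i)², and in particular the induced (Blaschke) metric given by Hess u is flat. -/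
open scoped Matrix

/-- The Hessian matrix `(∂²u/∂xʲ∂xᵏ(x))` of a real function `u` at `x`. -/
noncomputable def realHess (n : ℕ) (u : (Fin n → ℝ) → ℝ) (x : Fin n → ℝ) :
    Matrix (Fin n) (Fin n) ℝ :=
  Matrix.of fun j k => fderiv ℝ (fun y => fderiv ℝ u y (Pi.single k 1)) x (Pi.single j 1)

namespace CPJ

/-! ### Directional derivatives of smooth functions -/

/-- Directional derivative. -/
noncomputable def D {n : ℕ} (v : Fin n → ℝ) (f : (Fin n → ℝ) → ℝ) : (Fin n → ℝ) → ℝ :=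
  fun x => fderiv ℝ f x v

/-- Smoothness. -/
def Sm {n : ℕ} (f : (Fin n → ℝ) → ℝ) : Prop := ContDiff ℝ (⊤ : ℕ∞) f

variable {n : ℕ}

lemma Sm.D {f : (Fin n → ℝ) → ℝ} (hf : Sm f) (v : Fin n → ℝ) : Sm (D v f) := by
  unfold Sm CPJ.D at *
  exact (hf.fderiv_right (m := ((⊤ : ℕ∞) : WithTop ℕ∞)) le_rfl).clm_apply contDiff_const

lemma Sm.diff {f : (Fin n → ℝ) → ℝ} (hf : Sm f) : Differentiable ℝ f :=
  ContDiff.differentiable hf (by simp)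

lemma Sm.cont {f : (Fin n → ℝ) → ℝ} (hf : Sm f) : Continuous f :=
  ContDiff.continuous hf

lemma D_comm {f : (Fin n → ℝ) → ℝ} (hf : Sm f) (v w : Fin n → ℝ) :
    D v (D w f) = D w (D v f) := by
  funext x
  have h1 : Differentiable ℝ (fderiv ℝ f) :=
    (hf.fderiv_right (m := 1) (by norm_cast)).differentiable (by simp)
  have key : ∀ a b : Fin n → ℝ, D a (D b f) x = fderiv ℝ (fderiv ℝ f) x a b := by
    intro a b
    unfold D
    rw [fderiv_clm_apply (h1 x) (by fun_prop)]
    simp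
  rw [key, key]
  exact second_derivative_symmetric (fun y => (hf.diff y).hasFDerivAt) (h1 x).hasFDerivAt v w

lemma D_add_dir (v w : Fin n → ℝ) (f : (Fin n → ℝ) → ℝ) (x) :
    D (v + w) f x = D v f x + D w f x := by simp [D]

lemma D_smul_dir (c : ℝ) (v : Fin n → ℝ) (f : (Fin n → ℝ) → ℝ) (x) :
    D (c • v) f x = c * D v f x := by simp [D]

lemma D_sum_dir {ι : Type*} (s : Finset ι) (v : ι → Fin n → ℝ) (f : (Fin n → ℝ) → ℝ) (x) :
    D (∑ i ∈ s, v i) f x = ∑ i ∈ s, D (v i) f x := by simp [D]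

/-- linear combination in the direction, as functions, under one derivative -/
lemma D_lin_dir (t : ℝ) (v w : Fin n → ℝ) (f : (Fin n → ℝ) → ℝ) :
    D (v + t • w) f = fun x => D v f x + t * D w f x := by
  funext x; simp [D]

lemma D_lin_fun {f g : (Fin n → ℝ) → ℝ} (hf : Sm f) (hg : Sm g) (t : ℝ) (v : Fin n → ℝ) (x) :
    D v (fun y => f y + t * g y) x = D v f x + t * D v g x := by
  unfold D
  have h := (hf.diff x).hasFDerivAt.add ((hg.diff x).hasFDerivAt.const_mul t)
  have h2 : HasFDerivAt (fun y => f y + t * g y) (fderiv ℝ f x + t • fderiv ℝ g x) x := h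
  rw [h2.fderiv]
  simp

/-- Second derivative as a bilinear form. -/
noncomputable def H (u : (Fin n → ℝ) → ℝ) (x v w : Fin n → ℝ) : ℝ := D v (D w u) x

lemma H_symm {u : (Fin n → ℝ) → ℝ} (hu : Sm u) (x v w : Fin n → ℝ) : H u x v w = H u x w v := by
  unfold H; rw [D_comm hu]

lemma H_lin {u : (Fin n → ℝ) → ℝ} (t : ℝ) (x v w y : Fin n → ℝ) :
    H u x (v + t • w) y = H u x v y + t * H u x w y := by
  unfold H; rw [D_lin_dir]

lemma hasDerivAt_line {f : (Fin n → ℝ) → ℝ} (hf : Sm f) (x e : Fin n → ℝ) (t : ℝ) :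
    HasDerivAt (fun s : ℝ => f (x + s • e)) (D e f (x + t • e)) t := by
  have h1 : HasDerivAt (fun s : ℝ => x + s • e) e t := by
    simpa using ((hasDerivAt_id t).smul_const e).const_add x
  exact (hf.diff (x + t • e)).hasFDerivAt.comp_hasDerivAt t h1

lemma H_curve {u : (Fin n → ℝ) → ℝ} (hu : Sm u) (t : ℝ) (x v w : Fin n → ℝ) :
    H u x (v + t • w) (v + t • w) =
      D v (D v u) x + 2 * t * D v (D w u) x + t ^ 2 * D w (D w u) x := by
  unfold H
  rw [D_lin_dir, D_lin_dir]
  simp only []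
  rw [D_lin_fun (hu.D v) (hu.D w), D_lin_fun (hu.D v) (hu.D w), D_comm hu w v]
  ring

/-- third derivative as a cubic form -/
noncomputable def A3 (u : (Fin n → ℝ) → ℝ) (x v : Fin n → ℝ) : ℝ := D v (D v (D v u)) x

lemma A3_curve {u : (Fin n → ℝ) → ℝ} (hu : Sm u) (t : ℝ) (x v w : Fin n → ℝ) :
    A3 u x (v + t • w) =
      D v (D v (D v u)) x + 3 * t * D w (D v (D v u)) x + 3 * t ^ 2 * D w (D w (D v u)) x
        + t ^ 3 * D w (D w (D w u)) x := by
  have h2 : D (v + t • w) (D (v + t • w) u) = fun x => (D v (D v u) x + t * (D w (D v u) x)) +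
      t * ((D w (D v u) x) + t * D w (D w u) x) := by
    funext y
    have := H_curve hu t y v w
    unfold H at this
    rw [this, D_comm hu v w]; ring
  have s1 : Sm (fun x => (D v (D v u) x + t * (D w (D v u) x))) := by
    have a := ((hu.D v).D v); have b := ((hu.D v).D w)
    unfold Sm at *; fun_prop
  have s2 : Sm (fun x => (D w (D v u) x + t * (D w (D w u) x))) := by
    have a := ((hu.D v).D w); have b := ((hu.D w).D w)
    unfold Sm at *; fun_prop
  unfold A3
  rw [h2, D_lin_dir]
  simp only []
  rw [D_lin_fun s1 s2, D_lin_fun s1 s2, D_lin_fun ((hu.D v).D v) ((hu.D v).D w),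
    D_lin_fun ((hu.D v).D v) ((hu.D v).D w), D_lin_fun ((hu.D v).D w) ((hu.D w).D w),
    D_lin_fun ((hu.D v).D w) ((hu.D w).D w), D_comm (hu.D v) v w, D_comm (hu.D w) v w,
    D_comm hu v w]
  ring

/-! ### Second derivative test -/

lemma second_test {f f' : ℝ → ℝ} {f'' : ℝ} (h1 : ∀ t, HasDerivAt f (f' t) t)
    (h2 : HasDerivAt f' f'' 0) (hm : IsLocalMax f 0) : f' 0 = 0 ∧ f'' ≤ 0 := by
  have h0 : f' 0 = 0 := hm.hasDerivAt_eq_zero (h1 0)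
  refine ⟨h0, ?_⟩
  by_contra hc
  push Not at hc
  have hd : deriv f = f' := funext fun t => (h1 t).deriv
  have hmin : IsLocalMin f 0 := by
    apply isLocalMin_of_deriv_deriv_pos
    · rw [hd, h2.deriv]; exact hc
    · rw [hd, h0]
    · exact (h1 0).continuousAt
  have he : ∀ᶠ t in nhds (0:ℝ), f t = f 0 := by
    filter_upwards [hm, hmin] with t a b using le_antisymm a b
  have he2 : f' =ᶠ[nhds 0] fun _ => 0 := by
    filter_upwards [he.eventually_nhds] with t ht
    have : f =ᶠ[nhds t] fun _ => f 0 := ht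
    rw [← (h1 t).deriv, this.deriv_eq]; simp
  have := he2.deriv_eq
  rw [h2.deriv] at this
  simp at this
  linarith

/-! ### Determinants along curves -/

/-- entrywise derivative of a matrix curve -/
def MD (K : ℝ → Matrix (Fin n) (Fin n) ℝ) (K' : Matrix (Fin n) (Fin n) ℝ) (t : ℝ) : Prop :=
  ∀ i j, HasDerivAt (fun s => K s i j) (K' i j) t

lemma MD.mul {K L : ℝ → Matrix (Fin n) (Fin n) ℝ} {K' L' : Matrix (Fin n) (Fin n) ℝ} {t : ℝ}
    (hK : MD K K' t) (hL : MD L L' t) : MD (fun s => K s * L s) (K' * L t + K t * L') t := by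
  intro i j
  simp only [Matrix.mul_apply, Matrix.add_apply]
  rw [← Finset.sum_add_distrib]
  exact HasDerivAt.fun_sum fun k _ => (hK i k).mul (hL k j)

lemma MD.neg {K : ℝ → Matrix (Fin n) (Fin n) ℝ} {K' : Matrix (Fin n) (Fin n) ℝ} {t : ℝ}
    (hK : MD K K' t) : MD (fun s => - K s) (- K') t := fun i j => (hK i j).neg

lemma MD.trace {K : ℝ → Matrix (Fin n) (Fin n) ℝ} {K' : Matrix (Fin n) (Fin n) ℝ} {t : ℝ}
    (hK : MD K K' t) : HasDerivAt (fun s => (K s).trace) K'.trace t := by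
  simp only [Matrix.trace, Matrix.diag]
  exact HasDerivAt.fun_sum fun k _ => hK k k

lemma MD.unique {K : ℝ → Matrix (Fin n) (Fin n) ℝ} {K' L' : Matrix (Fin n) (Fin n) ℝ} {t : ℝ}
    (hK : MD K K' t) (hL : MD K L' t) : K' = L' := by
  ext i j; exact (hK i j).unique (hL i j)

lemma MD.det {K : ℝ → Matrix (Fin n) (Fin n) ℝ} {K' : Matrix (Fin n) (Fin n) ℝ} {t : ℝ}
    (hK : MD K K' t) : HasDerivAt (fun s => (K s).det) ((K t).adjugate * K').trace t := by
  have e : ((K t).adjugate * K').trace = ∑ i, ((K t).updateCol i (fun j => K' j i)).det := by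
    simp only [Matrix.trace, Matrix.diag]
    refine Finset.sum_congr rfl fun i _ => ?_
    rw [← Matrix.cramer_apply, Matrix.cramer_eq_adjugate_mulVec]
    rfl
  rw [e]
  have h : HasDerivAt (fun s => (K s).det) (∑ σ : Equiv.Perm (Fin n),
      ((Equiv.Perm.sign σ : ℤ) : ℝ) * ∑ i, (∏ j ∈ Finset.univ.erase i, K t (σ j) j) • K' (σ i) i) t := by
    simp only [Matrix.det_apply']
    refine HasDerivAt.fun_sum fun σ _ => HasDerivAt.const_mul _ ?_
    exact HasDerivAt.fun_finsetProd fun i _ => hK (σ i) i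
  convert h using 1
  simp only [Matrix.det_apply', Finset.mul_sum]
  rw [Finset.sum_comm]
  refine Finset.sum_congr rfl fun σ _ => Finset.sum_congr rfl fun i _ => ?_
  congr 1
  rw [← Finset.prod_erase_mul _ _ (Finset.mem_univ i)]
  simp only [Matrix.updateCol_self, smul_eq_mul]
  congr 1
  refine Finset.prod_congr rfl fun j hj => ?_
  rw [Matrix.updateCol_ne (Finset.ne_of_mem_erase hj)]

lemma MD.exists_adjugate {K : ℝ → Matrix (Fin n) (Fin n) ℝ} {K' : Matrix (Fin n) (Fin n) ℝ} {t : ℝ}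
    (hK : MD K K' t) : ∃ G', MD (fun s => (K s).adjugate) G' t := by
  have : ∀ i j, ∃ g, HasDerivAt (fun s => (K s).adjugate i j) g t := by
    intro i j
    simp only [Matrix.adjugate_apply]
    have : MD (fun s => (K s).updateRow j (Pi.single i 1)) (K'.updateRow j 0) t := by
      intro a b
      simp only [Matrix.updateRow_apply]
      split_ifs
      · exact hasDerivAt_const _ _
      · exact hK a b
    exact ⟨_, this.det⟩
  choose G' hG using this
  exact ⟨Matrix.of G', hG⟩

lemma det_const_identities {K K1 K2 K3 : ℝ → Matrix (Fin n) (Fin n) ℝ}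
    (h1 : ∀ t, MD K (K1 t) t) (h2 : ∀ t, MD K1 (K2 t) t) (h3 : ∀ t, MD K2 (K3 t) t)
    (hdet : ∀ t, (K t).det = 1) (h0 : K 0 = 1) :
    (K1 0).trace = 0 ∧ (K2 0).trace = (K1 0 * K1 0).trace ∧
    (K3 0).trace = 3 * (K1 0 * K2 0).trace - 2 * (K1 0 * K1 0 * K1 0).trace := by
  set G : ℝ → Matrix (Fin n) (Fin n) ℝ := fun s => (K s).adjugate with hG
  have GK : ∀ t, G t * K t = 1 := fun t => by simp [hG, Matrix.adjugate_mul, hdet]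
  have KG : ∀ t, K t * G t = 1 := fun t => by simp [hG, Matrix.mul_adjugate, hdet]
  have G0 : G 0 = 1 := by have := GK 0; rwa [h0, mul_one] at this
  have dG : ∀ t, MD G (-(G t * K1 t * G t)) t := by
    intro t
    obtain ⟨G', hG'⟩ := (h1 t).exists_adjugate
    have e1 := hG'.mul (h1 t)
    have e2 : MD (fun s => G s * K s) 0 t := by
      intro i j; simp only [GK]; exact hasDerivAt_const _ _
    have e3 : G' * K t + G t * K1 t = 0 := e1.unique e2
    have e4 : G' = -(G t * K1 t * G t) := by
      have : G' * K t = -(G t * K1 t) := eq_neg_of_add_eq_zero_left e3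
      calc G' = G' * K t * G t := by rw [mul_assoc, KG, mul_one]
        _ = _ := by rw [this, neg_mul]
    rw [← e4]; exact hG'
  have t1 : ∀ t, (G t * K1 t).trace = 0 := by
    intro t
    have a := (h1 t).det
    simp only [hdet] at a
    exact a.unique (hasDerivAt_const _ _)
  have t2 : ∀ t, (G t * K2 t).trace = (G t * K1 t * (G t * K1 t)).trace := by
    intro t
    have a := ((dG t).mul (h2 t)).trace
    simp only [t1] at a
    have := a.unique (hasDerivAt_const _ _)
    rw [Matrix.trace_add, neg_mul, Matrix.trace_neg] at this
    rw [← mul_assoc]; linarith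
  have t3 : (K3 0).trace = 3 * (K1 0 * K2 0).trace - 2 * (K1 0 * K1 0 * K1 0).trace := by
    have a := ((dG 0).mul (h3 0)).trace
    have d1 := (dG 0).mul (h2 0)
    have b := (d1.mul d1).trace
    simp only [t2] at a
    have := a.unique b
    simp only [G0, one_mul, mul_one, neg_mul, mul_neg, mul_add, add_mul, Matrix.trace_add,
      Matrix.trace_neg] at this
    have c1 : (K2 0 * K1 0).trace = (K1 0 * K2 0).trace := Matrix.trace_mul_comm _ _
    have c2 : (K1 0 * (K1 0 * K1 0)).trace = (K1 0 * K1 0 * K1 0).trace := by rw [mul_assoc]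
    linarith
  refine ⟨by simpa [G0] using t1 0, by simpa [G0] using t2 0, t3⟩

end CPJ

namespace CPJ
variable {n : ℕ}

/-! ### Frames -/

lemma diag_symm (M : Matrix (Fin n) (Fin n) ℝ) (hM : M.IsSymm) :
    ∃ (U : Matrix (Fin n) (Fin n) ℝ) (d : Fin n → ℝ), Uᵀ * U = 1 ∧ Uᵀ * M * U = Matrix.diagonal d := by
  have hH : M.IsHermitian := by
    rw [Matrix.IsHermitian, Matrix.conjTranspose_eq_transpose_of_trivial]; exact hM
  refine ⟨hH.eigenvectorUnitary, hH.eigenvalues, ?_, ?_⟩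
  · have := Unitary.coe_star_mul_self hH.eigenvectorUnitary
    rwa [Matrix.star_eq_conjTranspose, Matrix.conjTranspose_eq_transpose_of_trivial] at this
  · have := hH.conjStarAlgAut_star_eigenvectorUnitary
    rw [Unitary.conjStarAlgAut_star_apply, Matrix.star_eq_conjTranspose,
      Matrix.conjTranspose_eq_transpose_of_trivial] at this
    exact this

lemma simul_diag (M N : Matrix (Fin n) (Fin n) ℝ) (hM : M.PosDef) (hN : N.IsSymm) :
    ∃ (E : Matrix (Fin n) (Fin n) ℝ) (d : Fin n → ℝ), Eᵀ * M * E = 1 ∧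
      Eᵀ * N * E = Matrix.diagonal d := by
  have hMs : M.IsSymm := by
    have := hM.isHermitian
    rwa [Matrix.IsHermitian, Matrix.conjTranspose_eq_transpose_of_trivial] at this
  obtain ⟨U, d, hU, hd⟩ := diag_symm M hMs
  have hdpos : ∀ i, 0 < d i := by
    intro i
    have h1 : (Uᵀ * M * U) i i = d i := by rw [hd]; simp
    have hne : U *ᵥ (Pi.single i 1) ≠ 0 := by
      intro h0
      have : Uᵀ *ᵥ (U *ᵥ (Pi.single i 1)) = Pi.single i (1:ℝ) := by
        rw [Matrix.mulVec_mulVec, hU, Matrix.one_mulVec]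
      rw [h0, Matrix.mulVec_zero] at this
      have := congrFun this i
      simp at this
    have := hM.dotProduct_mulVec_pos hne
    have e : (Uᵀ * M * U) i i = (U *ᵥ Pi.single i 1) ⬝ᵥ (M *ᵥ (U *ᵥ Pi.single i 1)) := by
      rw [Matrix.mulVec_single_one, Matrix.mul_assoc, Matrix.mul_apply]
      rfl
    rw [← h1, e]
    simpa only [star_trivial] using this
  set S : Matrix (Fin n) (Fin n) ℝ := Matrix.diagonal fun i => 1 / Real.sqrt (d i) with hS
  have hST : Sᵀ = S := by simp [hS]
  have hP : (U * S)ᵀ * M * (U * S) = 1 := by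
    have : (U * S)ᵀ * M * (U * S) = S * (Uᵀ * M * U) * S := by
      rw [Matrix.transpose_mul, hST]; simp only [Matrix.mul_assoc]
    rw [this, hd, hS, Matrix.diagonal_mul_diagonal, Matrix.diagonal_mul_diagonal]
    rw [← Matrix.diagonal_one]
    congr 1; funext i
    have := Real.sq_sqrt (hdpos i).le
    have h2 := Real.sqrt_pos.2 (hdpos i)
    field_simp
    nlinarith
  have hN2 : ((U * S)ᵀ * N * (U * S)).IsSymm := by
    simp only [Matrix.IsSymm, Matrix.transpose_mul, Matrix.transpose_transpose, hN.eq,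
      Matrix.mul_assoc]
  obtain ⟨V, lam, hV, hl⟩ := diag_symm _ hN2
  refine ⟨U * S * V, lam, ?_, ?_⟩
  · calc _ = Vᵀ * ((U * S)ᵀ * M * (U * S)) * V := by
          rw [Matrix.transpose_mul _ V]; simp only [Matrix.mul_assoc]
      _ = 1 := by rw [hP, Matrix.mul_one, hV]
  · rw [← hl, Matrix.transpose_mul _ V]; simp only [Matrix.mul_assoc]

lemma pi_eq_sum_single (w : Fin n → ℝ) : w = ∑ k, w k • (Pi.single k 1 : Fin n → ℝ) := by
  funext i
  simp [Finset.sum_apply, Pi.single_apply]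

lemma D_sum_fun {ι : Type*} (s : Finset ι) (c : ι → ℝ) {f : ι → (Fin n → ℝ) → ℝ}
    (hf : ∀ i, Sm (f i)) (v x : Fin n → ℝ) :
    D v (fun y => ∑ i ∈ s, c i * f i y) x = ∑ i ∈ s, c i * D v (f i) x := by
  unfold D
  have : HasFDerivAt (fun y => ∑ i ∈ s, c i * f i y) (∑ i ∈ s, c i • fderiv ℝ (f i) x) x :=
    HasFDerivAt.fun_sum fun i _ => ((hf i).diff x).hasFDerivAt.const_mul (c i)
  rw [this.fderiv]; simp

lemma H_sum_right {u : (Fin n → ℝ) → ℝ} (hu : Sm u) (c : Fin n → ℝ) (e : Fin n → Fin n → ℝ)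
    (x v : Fin n → ℝ) : H u x v (∑ k, c k • e k) = ∑ k, c k * H u x v (e k) := by
  unfold H
  have : D (∑ k, c k • e k) u = fun y => ∑ k, c k * D (e k) u y := by
    funext y; rw [D_sum_dir]; simp only [D_smul_dir]
  rw [this, D_sum_fun _ _ (fun i => hu.D _)]

lemma H_sum_left {u : (Fin n → ℝ) → ℝ} (c : Fin n → ℝ) (e : Fin n → Fin n → ℝ)
    (x v : Fin n → ℝ) : H u x (∑ k, c k • e k) v = ∑ k, c k * H u x (e k) v := by
  unfold H
  rw [D_sum_dir]; simp only [D_smul_dir]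

lemma H_eq_dot {u : (Fin n → ℝ) → ℝ} (hu : Sm u) (x v w : Fin n → ℝ) :
    H u x v w = v ⬝ᵥ (realHess n u x *ᵥ w) := by
  conv_lhs => rw [pi_eq_sum_single v, pi_eq_sum_single w]
  rw [H_sum_left]
  simp only [dotProduct, Matrix.mulVec]
  refine Finset.sum_congr rfl fun j _ => ?_
  rw [H_sum_right hu]
  congr 1
  refine Finset.sum_congr rfl fun k _ => ?_
  rw [mul_comm]; rfl

lemma conj_apply {u : (Fin n → ℝ) → ℝ} (hu : Sm u) (x : Fin n → ℝ) (E : Matrix (Fin n) (Fin n) ℝ)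
    (i j : Fin n) : (Eᵀ * realHess n u x * E) i j = H u x (fun a => E a i) (fun a => E a j) := by
  rw [H_eq_dot hu, Matrix.mul_assoc, Matrix.mul_apply]
  rfl

lemma exists_frame {u : (Fin n → ℝ) → ℝ} (hu : Sm u) (hpos : ∀ x, (realHess n u x).PosDef)
    (hdet : ∀ x, (realHess n u x).det = 1) (x v : Fin n → ℝ) :
    ∃ (e : Fin n → Fin n → ℝ) (lam : Fin n → ℝ),
      (∀ i j, H u x (e i) (e j) = if i = j then 1 else 0) ∧
      (∀ i j, H (D v u) x (e i) (e j) = if i = j then lam i else 0) ∧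
      (∀ y, y = ∑ i, H u x y (e i) • e i) ∧
      ∑ i, lam i = 0 ∧
      ∑ i, H (D v (D v u)) x (e i) (e i) = ∑ i, lam i ^ 2 ∧
      ∑ i, H (D v (D v (D v u))) x (e i) (e i) =
        3 * ∑ i, lam i * H (D v (D v u)) x (e i) (e i) - 2 * ∑ i, lam i ^ 3 := by
  have hsym : ∀ f : (Fin n → ℝ) → ℝ, Sm f → (realHess n f x).IsSymm := by
    intro f hf
    ext i j
    exact H_symm hf x (Pi.single j 1) (Pi.single i 1)
  obtain ⟨E, lam, hE, hl⟩ := simul_diag _ _ (hpos x) (hsym _ (hu.D v))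
  have md : ∀ f : (Fin n → ℝ) → ℝ, Sm f → ∀ t, MD (fun t => Eᵀ * realHess n f (x + t • v) * E)
      (Eᵀ * realHess n (D v f) (x + t • v) * E) t := by
    intro f hf t i j
    simp only [conj_apply hf, conj_apply (hf.D v)]
    have h := hasDerivAt_line ((hf.D (fun a => E a j)).D (fun a => E a i)) x v t
    unfold H
    rw [D_comm (hf.D _) v, D_comm hf v] at h
    exact h
  have hdetE : E.det * E.det = 1 := by
    have := congrArg Matrix.det hE
    rw [Matrix.det_mul, Matrix.det_mul, hdet, Matrix.det_transpose, Matrix.det_one] at this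
    linarith
  have K := det_const_identities (md u hu) (md _ (hu.D v)) (md _ ((hu.D v).D v))
    (fun t => by
      rw [Matrix.det_mul, Matrix.det_mul, hdet, Matrix.det_transpose]; linarith)
    (by simpa using hE)
  simp only [zero_smul, add_zero] at K
  rw [hl] at K
  obtain ⟨k1, k2, k3⟩ := K
  have htr : ∀ f : (Fin n → ℝ) → ℝ, Sm f → (Eᵀ * realHess n f x * E).trace =
      ∑ i, H f x (fun a => E a i) (fun a => E a i) := by
    intro f hf
    simp only [Matrix.trace, Matrix.diag, conj_apply hf]
  refine ⟨fun i a => E a i, lam, ?_, ?_, ?_, ?_, ?_, ?_⟩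
  · intro i j
    rw [← conj_apply hu, hE, Matrix.one_apply]
  · intro i j
    rw [← conj_apply (hu.D v), hl, Matrix.diagonal_apply]
  · intro y
    have hE2 : E * (Eᵀ * realHess n u x) = 1 := mul_eq_one_comm.1 hE
    have h1 : E *ᵥ ((Eᵀ * realHess n u x) *ᵥ y) = y := by
      rw [Matrix.mulVec_mulVec, hE2, Matrix.one_mulVec]
    have h2 : ∀ i, ((Eᵀ * realHess n u x) *ᵥ y) i = H u x y (fun a => E a i) := by
      intro i
      rw [H_symm hu, H_eq_dot hu, ← Matrix.mulVec_mulVec]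
      rfl
    conv_lhs => rw [← h1]
    funext a
    simp only [Matrix.mulVec, dotProduct, Finset.sum_apply, Pi.smul_apply, smul_eq_mul] at h2 ⊢
    refine Finset.sum_congr rfl fun i _ => ?_
    rw [h2, mul_comm]
  · simpa using k1
  · rw [htr _ ((hu.D v).D v), Matrix.diagonal_mul_diagonal, Matrix.trace_diagonal] at k2
    rw [k2]
    exact Finset.sum_congr rfl fun i _ => by ring
  · rw [htr _ (((hu.D v).D v).D v), Matrix.diagonal_mul_diagonal, Matrix.diagonal_mul_diagonal,
      Matrix.trace_diagonal] at k3
    rw [k3]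
    congr 2
    · simp only [Matrix.trace, Matrix.diag, Matrix.diagonal_mul]
      exact Finset.sum_congr rfl fun i _ => by rw [conj_apply ((hu.D v).D v)]
    · exact Finset.sum_congr rfl fun i _ => by ring

end CPJ

namespace CPJ
variable {n : ℕ}

/-! ### 2-jets of functions of one variable -/

/-- `J f a b c`: `f` is differentiable, with value `a`, derivative `b` and second derivative `c`
at `0`. -/
def J (f : ℝ → ℝ) (a b c : ℝ) : Prop :=
  f 0 = a ∧ ∃ f' : ℝ → ℝ, (∀ t, HasDerivAt f (f' t) t) ∧ f' 0 = b ∧ HasDerivAt f' c 0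

lemma J.add {f g : ℝ → ℝ} {a b c a' b' c' : ℝ} (hf : J f a b c) (hg : J g a' b' c') :
    J (fun t => f t + g t) (a + a') (b + b') (c + c') := by
  obtain ⟨h0, f', h1, h2, h3⟩ := hf
  obtain ⟨k0, g', k1, k2, k3⟩ := hg
  exact ⟨by simp [h0, k0], fun t => f' t + g' t, fun t => (h1 t).add (k1 t), by simp [h2, k2],
    h3.add k3⟩

lemma J.mul {f g : ℝ → ℝ} {a b c a' b' c' : ℝ} (hf : J f a b c) (hg : J g a' b' c') :
    J (fun t => f t * g t) (a * a') (b * a' + a * b') (c * a' + 2 * b * b' + a * c') := by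
  obtain ⟨h0, f', h1, h2, h3⟩ := hf
  obtain ⟨k0, g', k1, k2, k3⟩ := hg
  refine ⟨by simp [h0, k0], fun t => f' t * g t + f t * g' t, fun t => (h1 t).mul (k1 t),
    by simp [h0, h2, k0, k2], ?_⟩
  have := (h3.mul (k1 0)).add ((h1 0).mul k3)
  have e : c * a' + 2 * b * b' + a * c' = c * g 0 + f' 0 * g' 0 + (f' 0 * g' 0 + f 0 * c') := by
    rw [h0, h2, k0, k2]; ring
  rw [e]; exact this

lemma J.const (k : ℝ) : J (fun _ => k) k 0 0 :=
  ⟨rfl, fun _ => 0, fun t => hasDerivAt_const t k, rfl, hasDerivAt_const _ _⟩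

lemma J.id : J (fun t => t) 0 1 0 :=
  ⟨rfl, fun _ => 1, fun t => hasDerivAt_id t, rfl, hasDerivAt_const _ _⟩

lemma J.congr {f g : ℝ → ℝ} {a b c a' b' c' : ℝ} (hf : J f a b c) (h : ∀ t, g t = f t)
    (ha : a' = a) (hb : b' = b) (hc : c' = c) : J g a' b' c' := by
  have : g = f := funext h
  subst this ha hb hc
  exact hf

lemma J.pow {f : ℝ → ℝ} {a b c : ℝ} (hf : J f a b c) (k : ℕ) :
    J (fun t => f t ^ (k + 2)) (a ^ (k + 2)) ((k + 2) * a ^ (k + 1) * b)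
      ((k + 2) * (k + 1) * a ^ k * b ^ 2 + (k + 2) * a ^ (k + 1) * c) := by
  induction k with
  | zero =>
    refine (hf.mul hf).congr (fun t => by ring) (by ring) ?_ ?_ <;> norm_num <;> ring
  | succ k ih =>
    refine (ih.mul hf).congr (fun t => by ring) (by ring) ?_ ?_ <;> push_cast <;> ring

lemma J.line {f : (Fin n → ℝ) → ℝ} (hf : Sm f) (x e : Fin n → ℝ) :
    J (fun t => f (x + t • e)) (f x) (D e f x) (D e (D e f) x) := by
  refine ⟨by simp, fun t => D e f (x + t • e), fun t => hasDerivAt_line hf x e t, by simp, ?_⟩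
  simpa using hasDerivAt_line (hf.D e) x e 0

lemma J.test {f : ℝ → ℝ} {a b c : ℝ} (hf : J f a b c) (hm : IsLocalMax f 0) : b = 0 ∧ c ≤ 0 := by
  obtain ⟨h0, f', h1, h2, h3⟩ := hf
  rw [← h2]
  exact second_test h1 h3 hm

lemma D_smul_fun {f : (Fin n → ℝ) → ℝ} (hf : Sm f) (c : ℝ) (v x : Fin n → ℝ) :
    D v (fun y => c * f y) x = c * D v f x := by
  unfold D
  have h : HasFDerivAt (fun y => c * f y) (c • fderiv ℝ f x) x :=
    (hf.diff x).hasFDerivAt.const_mul c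
  rw [h.fderiv]; simp

lemma D_smul_dir2 {f : (Fin n → ℝ) → ℝ} (hf : Sm f) (c : ℝ) (v w x : Fin n → ℝ) :
    D v (D (c • w) f) x = c * D v (D w f) x := by
  have : D (c • w) f = fun y => c * D w f y := by funext y; rw [D_smul_dir]
  rw [this, D_smul_fun (hf.D w)]

lemma D_zero_dir (f : (Fin n → ℝ) → ℝ) (x : Fin n → ℝ) : D 0 f x = 0 := by simp [D]

lemma J_hess {u : (Fin n → ℝ) → ℝ} (hu : Sm u) (x e v w : Fin n → ℝ) :
    J (fun t => H u (x + t • e) (v + t • w) (v + t • w)) (H u x v v)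
      (D e (D v (D v u)) x + 2 * D v (D w u) x)
      (D e (D e (D v (D v u))) x + 4 * D e (D v (D w u)) x + 2 * D w (D w u) x) := by
  have a := J.line ((hu.D v).D v) x e
  have b := J.line ((hu.D w).D v) x e
  have c := J.line ((hu.D w).D w) x e
  refine ((a.add (((J.const 2).mul J.id).mul b)).add ((J.id.mul J.id).mul c)).congr
    (fun t => ?_) ?_ ?_ ?_
  · rw [H_curve hu]; ring
  · unfold H; ring
  · ring
  · ring

lemma J_cubic {u : (Fin n → ℝ) → ℝ} (hu : Sm u) (x e v w : Fin n → ℝ) :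
    J (fun t => A3 u (x + t • e) (v + t • w)) (A3 u x v)
      (D e (D v (D v (D v u))) x + 3 * D w (D v (D v u)) x)
      (D e (D e (D v (D v (D v u)))) x + 6 * D e (D w (D v (D v u))) x
        + 6 * D w (D w (D v u)) x) := by
  have a := J.line (((hu.D v).D v).D v) x e
  have b := J.line (((hu.D v).D v).D w) x e
  have c := J.line (((hu.D v).D w).D w) x e
  have d := J.line (((hu.D w).D w).D w) x e
  refine (((a.add (((J.const 3).mul J.id).mul b)).add (((J.const 3).mul (J.id.mul J.id)).mul c)).add
    ((J.id.mul (J.id.mul J.id)).mul d)).congr (fun t => ?_) ?_ ?_ ?_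
  · rw [A3_curve hu]; ring
  · unfold A3; ring
  · ring
  · ring

lemma J_grad {u : (Fin n → ℝ) → ℝ} (hu : Sm u) (x e v w : Fin n → ℝ) :
    J (fun t => D (v + t • w) u (x + t • e)) (D v u x)
      (D e (D v u) x + D w u x) (D e (D e (D v u)) x + 2 * D e (D w u) x) := by
  have a := J.line (hu.D v) x e
  have b := J.line (hu.D w) x e
  refine (a.add (J.id.mul b)).congr (fun t => ?_) ?_ ?_ ?_
  · rw [D_lin_dir]
  · ring
  · ring
  · ring

lemma J_rho {u : (Fin n → ℝ) → ℝ} (hu : Sm u) (M : ℝ) (x e : Fin n → ℝ) :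
    J (fun t => M - u (x + t • e)) (M - u x) (- D e u x) (- H u x e e) := by
  refine ((J.const M).add ((J.const (-1)).mul (J.line hu x e))).congr (fun t => ?_) ?_ ?_ ?_
  · ring
  · ring
  · ring
  · unfold H; ring

lemma eventually_lt {u : (Fin n → ℝ) → ℝ} (hu : Sm u) {M : ℝ} {x : Fin n → ℝ} (hx : u x < M)
    (e : Fin n → ℝ) : ∀ᶠ t : ℝ in nhds 0, u (x + t • e) < M := by
  have hc : Continuous fun t : ℝ => u (x + t • e) :=
    hu.cont.comp (by fun_prop)
  exact hc.continuousAt.eventually_lt continuousAt_const (by simpa using hx)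

/-! ### Elementary inequalities -/

lemma traceless (hn : 0 < n) (lam : Fin n → ℝ) (h0 : ∑ i, lam i = 0) (l : Fin n) :
    ((n : ℝ) + 1) * lam l ^ 2 ≤ n * ∑ i, lam i ^ 2 := by
  have h1 := Finset.sum_erase_add Finset.univ lam (Finset.mem_univ l)
  have h2 := Finset.sum_erase_add Finset.univ (fun i => lam i ^ 2) (Finset.mem_univ l)
  have h3 := sq_sum_le_card_mul_sum_sq (s := Finset.univ.erase l) (f := lam)
  rw [Finset.card_erase_of_mem (Finset.mem_univ l), Finset.card_univ, Fintype.card_fin,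
    Nat.cast_sub hn] at h3
  have h4 : 0 ≤ ∑ i ∈ Finset.univ.erase l, lam i ^ 2 := Finset.sum_nonneg fun i _ => sq_nonneg _
  have h5 : ∑ i ∈ Finset.univ.erase l, lam i = - lam l := by linarith
  rw [h5] at h3
  rw [← h2]
  push_cast at h3
  nlinarith

lemma grad_algebra {N ρ q S μ : ℝ} (hN : 1 ≤ N) (hρ : 0 < ρ) (hq : 0 < q)
    (h1 : ρ * (2 - μ) = 2 * N * q) (h2 : (N + 1) * μ ^ 2 ≤ N * S)
    (h3 : ρ ^ 2 * (2 * N + S) ≤ N * (2 * N) * ρ * q + 2 * N * (2 * N + 1) * q ^ 2) :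
    q ≤ (N + 8) * ρ := by
  have e : ρ * μ = 2 * ρ - 2 * N * q := by linarith
  have h4 : (N + 1) * (2 * ρ - 2 * N * q) ^ 2 ≤ N * (ρ ^ 2 * S) := by
    rw [← e]; nlinarith [mul_le_mul_of_nonneg_left h2 (sq_nonneg ρ)]
  have h5 : N * (ρ ^ 2 * (2 * N + S)) ≤
      N * (N * (2 * N) * ρ * q + 2 * N * (2 * N + 1) * q ^ 2) :=
    mul_le_mul_of_nonneg_left h3 (by linarith)
  have h6 : 2 * N ^ 2 * q ^ 2 + (2 * N ^ 2 + 4 * N + 4) * ρ ^ 2 ≤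
      (2 * N ^ 3 + 8 * N * (N + 1)) * (ρ * q) := by nlinarith
  have h7 : 2 * N ^ 2 * q ^ 2 ≤ (2 * N ^ 3 + 8 * N * (N + 1)) * (ρ * q) := by
    have : 0 ≤ (2 * N ^ 2 + 4 * N + 4) * ρ ^ 2 := by positivity
    linarith
  have h8 : 2 * N ^ 3 + 8 * N * (N + 1) ≤ 2 * N ^ 2 * (N + 8) := by nlinarith
  have h9 : 2 * N ^ 2 * q ^ 2 ≤ 2 * N ^ 2 * (N + 8) * (ρ * q) :=
    h7.trans (mul_le_mul_of_nonneg_right h8 (by positivity))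
  have h10 : (2 * N ^ 2 * q) * q ≤ (2 * N ^ 2 * q) * ((N + 8) * ρ) := by nlinarith
  exact le_of_mul_le_mul_left h10 (by positivity)

/-! ### The gradient estimate at a maximum point -/

lemma grad_max (hn : 0 < n) {u : (Fin n → ℝ) → ℝ} (hu : Sm u) (hpos : ∀ x, (realHess n u x).PosDef)
    (hdet : ∀ x, (realHess n u x).det = 1) (x v : Fin n → ℝ) (M q : ℝ) (hx : u x < M)
    (hq : 0 < q) (hq1 : D v u x = q) (hq2 : H u x v v = q)
    (hmax : ∀ y, u y < M → ∀ w, (M - u y) ^ (2 * n) * (2 * D w u y - H u y w w)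
      ≤ (M - u x) ^ (2 * n) * q) :
    q ≤ (n + 8) * (M - u x) := by
  obtain ⟨m, rfl⟩ : ∃ m, n = m + 1 := ⟨n - 1, by omega⟩
  set ρ := M - u x with hρ
  have hρ0 : 0 < ρ := by linarith
  have key : ∀ e w : Fin (m+1) → ℝ,
      ρ * (2 * (D e (D v u) x + D w u x) - (D e (D v (D v u)) x + 2 * D v (D w u) x))
        = 2 * (m + 1) * D e u x * q ∧
      2 * (m + 1) * (2 * m + 1) * (D e u x) ^ 2 * q - 2 * (m + 1) * ρ * H u x e e * q
      - 2 * (2 * (m + 1)) * ρ * D e u x *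
        (2 * (D e (D v u) x + D w u x) - (D e (D v (D v u)) x + 2 * D v (D w u) x))
      + ρ ^ 2 * (2 * (D e (D e (D v u)) x + 2 * D e (D w u) x) -
       (D e (D e (D v (D v u))) x + 4 * D e (D v (D w u)) x + 2 * D w (D w u) x)) ≤ 0 := by
    intro e w
    have jr := (J_rho hu M x e).pow (2 * m)
    have jq := ((J.const 2).mul (J_grad hu x e v w)).add ((J.const (-1)).mul (J_hess hu x e v w))
    have jj := jr.mul jq
    have loc : IsLocalMax (fun t : ℝ => (M - u (x + t • e)) ^ (2 * m + 2) *
        (2 * D (v + t • w) u (x + t • e) + -1 * H u (x + t • e) (v + t • w) (v + t • w))) 0 := by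
      filter_upwards [eventually_lt hu hx e] with t ht
      have := hmax (x + t • e) ht (v + t • w)
      simp only [zero_smul, add_zero, hq1, hq2]
      rw [show 2 * (m + 1) = 2 * m + 2 by ring] at this
      calc _ = (M - u (x + t • e)) ^ (2 * m + 2) *
          (2 * D (v + t • w) u (x + t • e) - H u (x + t • e) (v + t • w) (v + t • w)) := by ring
        _ ≤ _ := this
        _ = _ := by ring
    obtain ⟨b0, c0⟩ := jj.test loc
    rw [hq1, hq2, ← hρ] at b0 c0
    push_cast at b0 c0
    have p0 : 0 < ρ ^ (2 * m) := by positivity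
    have p1 : 0 < ρ ^ (2 * m + 1) := by positivity
    constructor
    · apply mul_left_cancel₀ p1.ne'
      rw [pow_succ ρ (2 * m + 1)] at b0
      linear_combination b0
    · refine le_of_mul_le_mul_left ?_ p0
      rw [pow_succ ρ (2 * m + 1), pow_succ ρ (2 * m)] at c0
      rw [mul_zero]
      refine le_of_eq_of_le ?_ c0
      ring
  -- first order condition in `v`
  have foc : ∀ w, D w u x = H u x v w := by
    intro w
    have h := (key 0 w).1
    simp only [D_zero_dir] at h
    unfold H
    have : ρ * (D w u x - D v (D w u) x) = 0 := by linarith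
    rcases mul_eq_zero.1 this with h | h <;> linarith
  obtain ⟨e, lam, he, hl, hexp, t1, t2, -⟩ := exists_frame hu hpos hdet x v
  set s : Fin (m + 1) → ℝ := fun i => H u x v (e i) with hs
  have hA : ∀ i, H (D v u) x (e i) v = lam i * s i := by
    intro i
    have h1 : H (D v u) x (e i) (∑ j, H u x v (e j) • e j) = H (D v u) x (e i) v := by
      rw [← hexp v]
    rw [← h1, H_sum_right (hu.D v)]
    simp [hl, hs, mul_comm]
  have hqs : ∑ i, s i ^ 2 = q := by
    have h1 : H u x v (∑ i, H u x v (e i) • e i) = H u x v v := by rw [← hexp v]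
    rw [H_sum_right hu, hq2] at h1
    rw [← h1]
    exact Finset.sum_congr rfl fun i _ => by simp only [hs]; ring
  have fl : ∀ i, ρ * ((2 - lam i) * s i) = 2 * (m + 1) * s i * q ∧
      - 2 * (m + 1) * (2 * m + 3) * s i ^ 2 * q - 2 * (m + 1) * ρ * q
      + ρ ^ 2 * (2 * lam i - H (D v (D v u)) x (e i) (e i) + 2 * (1 - lam i) ^ 2) ≤ 0 := by
    intro i
    have k := key (e i) ((1 - lam i) • e i)
    have f1 : D (e i) u x = s i := foc (e i)
    have f2 : D (e i) (D v u) x = s i := by rw [D_comm hu]; rfl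
    have f3 : D (e i) (D v (D v u)) x = lam i * s i := hA i
    have f4 : D v (D ((1 - lam i) • e i) u) x = (1 - lam i) * s i := D_smul_dir2 hu _ _ _ _
    have f5 : D (e i) (D (e i) (D v u)) x = lam i := by
      have := hl i i; simp only [if_true] at this; exact this
    have f6 : D (e i) (D ((1 - lam i) • e i) u) x = (1 - lam i) := by
      have := he i i; simp only [if_true] at this; unfold H at this
      rw [D_smul_dir2 hu, this, mul_one]
    have f7 : D (e i) (D v (D ((1 - lam i) • e i) u)) x = (1 - lam i) * lam i := by
      rw [D_comm hu, D_smul_dir2 (hu.D v), f5]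
    have f8 : D ((1 - lam i) • e i) (D ((1 - lam i) • e i) u) x = (1 - lam i) ^ 2 := by
      rw [D_smul_dir, f6]; ring
    have f9 : D (e i) (D (e i) (D v (D v u))) x = H (D v (D v u)) x (e i) (e i) := rfl
    have f10 : H u x (e i) (e i) = 1 := by have := he i i; simpa using this
    rw [f2, f3, f4, f5, f6, f7, f8, f9, f10, D_smul_dir, f1] at k
    obtain ⟨k1, k2⟩ := k
    have k1' : ρ * ((2 - lam i) * s i) = 2 * (m + 1) * s i * q := by linear_combination k1
    refine ⟨k1', ?_⟩
    refine le_of_eq_of_le ?_ k2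
    linear_combination (2 * (2 * (m + 1)) * s i) * k1'
  have hsum := Finset.sum_nonpos (s := Finset.univ) fun i _ => (fl i).2
  have hsum2 : - 2 * (m + 1) * (2 * m + 3) * q * q - 2 * (m + 1) * ρ * q * (m + 1)
      + ρ ^ 2 * (2 * (m + 1) + ∑ i, lam i ^ 2) ≤ 0 := by
    refine le_of_eq_of_le ?_ hsum
    have E : ∑ i, (2 * lam i - H (D v (D v u)) x (e i) (e i) + 2 * (1 - lam i) ^ 2) =
        2 * (m + 1) + ∑ i, lam i ^ 2 := by
      have : ∀ i, 2 * lam i - H (D v (D v u)) x (e i) (e i) + 2 * (1 - lam i) ^ 2 =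
        2 - 2 * lam i + 2 * lam i ^ 2 - H (D v (D v u)) x (e i) (e i) := fun i => by ring
      simp only [this, Finset.sum_sub_distrib, Finset.sum_add_distrib, ← Finset.mul_sum, t1, t2]
      simp
      ring
    rw [Finset.sum_add_distrib, Finset.sum_sub_distrib, Finset.sum_const, ← Finset.sum_mul,
      ← Finset.mul_sum, ← Finset.mul_sum, E, hqs]
    simp
    ring
  obtain ⟨l, hsl⟩ : ∃ l, s l ≠ 0 := by
    by_contra hc
    push Not at hc
    simp [hc] at hqs
    linarith
  have hmu : ρ * (2 - lam l) = 2 * ((m : ℝ) + 1) * q := by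
    apply mul_right_cancel₀ hsl
    linear_combination (fl l).1
  have htl := traceless hn lam t1 l
  push_cast at htl ⊢
  exact grad_algebra (by linarith [(Nat.cast_nonneg m : (0:ℝ) ≤ m)]) hρ0 hq hmu htl
    (by linarith)

end CPJ

namespace CPJ
variable {n : ℕ}

/-! ### The third order estimate at a maximum point -/

lemma cubic_max {u : (Fin n → ℝ) → ℝ} (hu : Sm u) (hpos : ∀ x, (realHess n u x).PosDef)
    (hdet : ∀ x, (realHess n u x).det = 1) (x v : Fin n → ℝ) (M a Γ : ℝ) (hx : u x < M)
    (ha : 0 < a) (ha1 : A3 u x v = a) (hv : H u x v v = 1)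
    (hΓ : ∀ e, (D e u x) ^ 2 ≤ Γ * H u x e e)
    (hmax : ∀ y, u y < M → ∀ w, (M - u y) * A3 u y w
      ≤ (M - u x) * a * ((H u y w w + H u y w w ^ 2) / 2)) :
    (M - u x) ^ 2 * a ^ 2 ≤ 4 * n * (M - u x) + 8 * n * Γ := by
  set ρ := M - u x with hρ
  have hρ0 : 0 < ρ := by linarith
  have key : ∀ e w : Fin n → ℝ,
      (- D e u x * a + ρ * (D e (D v (D v (D v u))) x + 3 * D w (D v (D v u)) x)
        - ρ * a * (3 / 2 * (D e (D v (D v u)) x + 2 * D v (D w u) x)) = 0) ∧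
      (- H u x e e * a
        - 2 * D e u x * (D e (D v (D v (D v u))) x + 3 * D w (D v (D v u)) x)
        + ρ * (D e (D e (D v (D v (D v u)))) x + 6 * D e (D w (D v (D v u))) x
          + 6 * D w (D w (D v u)) x)
        - ρ * a * (3 / 2 * (D e (D e (D v (D v u))) x + 4 * D e (D v (D w u)) x
            + 2 * D w (D w u) x) + (D e (D v (D v u)) x + 2 * D v (D w u) x) ^ 2) ≤ 0) := by
    intro e w
    have jr := J_rho hu M x e
    have jc := J_cubic hu x e v w
    have jh := J_hess hu x e v w
    have jj := (jr.mul jc).add ((J.const (-(ρ * a) / 2)).mul (jh.add (jh.mul jh)))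
    have loc := (jj.test ?_)
    · obtain ⟨b0, c0⟩ := loc
      rw [hv, ha1, ← hρ] at b0 c0
      constructor
      · linear_combination b0
      · refine le_of_eq_of_le ?_ c0
        ring
    · filter_upwards [eventually_lt hu hx e] with t ht
      have := hmax (x + t • e) ht (v + t • w)
      simp only [zero_smul, add_zero, ha1, hv, ← hρ]
      linarith
  have foc : ∀ w, D w (D v (D v u)) x = a * H u x v w := by
    intro w
    have h := (key 0 w).1
    simp only [D_zero_dir] at h
    unfold H
    have : ρ * (D w (D v (D v u)) x - a * D v (D w u) x) = 0 := by linarith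
    rcases mul_eq_zero.1 this with h | h <;> linarith
  have soc : ∀ w, H u x v w = 0 → D w (D w (D v u)) x ≤ a / 2 * H u x w w := by
    intro w hw
    have h := (key 0 w).2
    have hw' : D v (D w u) x = 0 := hw
    have h0 : H u x 0 0 = 0 := D_zero_dir _ _
    simp only [D_zero_dir, hw', h0] at h
    have h2 : ρ * (6 * D w (D w (D v u)) x) ≤ ρ * (3 * a * H u x w w) := by
      unfold H; linarith
    have := le_of_mul_le_mul_left h2 hρ0
    linarith
  obtain ⟨e, lam, he, hl, hexp, t1, t2, t3⟩ := exists_frame hu hpos hdet x v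
  set s : Fin n → ℝ := fun i => H u x v (e i) with hs
  have hA : ∀ i, H (D v u) x (e i) v = lam i * s i := by
    intro i
    have h1 : H (D v u) x (e i) (∑ j, H u x v (e j) • e j) = H (D v u) x (e i) v := by
      rw [← hexp v]
    rw [← h1, H_sum_right (hu.D v)]
    simp [hl, hs, mul_comm]
  have hqs : ∑ i, s i ^ 2 = 1 := by
    have h1 : H u x v (∑ i, H u x v (e i) • e i) = H u x v v := by rw [← hexp v]
    rw [H_sum_right hu, hv] at h1
    rw [← h1]
    exact Finset.sum_congr rfl fun i _ => by simp only [hs]; ring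
  have hls : ∀ i, lam i * s i = a * s i := by
    intro i
    rw [← hA i]
    exact foc (e i)
  have hll : ∀ i, lam i ≤ a := by
    intro i
    by_cases h : s i = 0
    · have h1 := soc (e i) h
      have f5 : D (e i) (D (e i) (D v u)) x = lam i := by
        have := hl i i; simp only [if_true] at this; exact this
      have f10 : H u x (e i) (e i) = 1 := by have := he i i; simpa using this
      rw [f5, f10] at h1
      linarith
    · exact (mul_right_cancel₀ h (hls i)).le
  set B : Fin n → ℝ := fun i => H (D v (D v u)) x (e i) (e i) with hB
  set C : Fin n → ℝ := fun i => H (D v (D v (D v u))) x (e i) (e i) with hC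
  have fl : ∀ i, - a * ρ - 2 * Γ * a + ρ ^ 2 * (C i - 3 * lam i * B i + 3 / 2 * lam i ^ 3)
      - ρ ^ 2 * a * (3 / 2 * (B i - 3 / 2 * lam i ^ 2)) ≤ 0 := by
    intro i
    have k := key (e i) ((- lam i / 2) • e i)
    have f3 : D (e i) (D v (D v u)) x = lam i * s i := hA i
    have f4 : D v (D ((- lam i / 2) • e i) u) x = (- lam i / 2) * s i := D_smul_dir2 hu _ _ _ _
    have f5 : D (e i) (D (e i) (D v u)) x = lam i := by
      have := hl i i; simp only [if_true] at this; exact this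
    have f10 : H u x (e i) (e i) = 1 := by have := he i i; simpa using this
    have f6 : D (e i) (D ((- lam i / 2) • e i) u) x = (- lam i / 2) := by
      have := f10; unfold H at this
      rw [D_smul_dir2 hu, this, mul_one]
    have f7 : D (e i) (D v (D ((- lam i / 2) • e i) u)) x = (- lam i / 2) * lam i := by
      rw [D_comm hu, D_smul_dir2 (hu.D v), f5]
    have f8 : D ((- lam i / 2) • e i) (D ((- lam i / 2) • e i) u) x = (- lam i / 2) ^ 2 := by
      rw [D_smul_dir, f6]; ring
    have f9 : D (e i) (D (e i) (D v (D v u))) x = B i := rfl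
    have f11 : D (e i) (D (e i) (D v (D v (D v u)))) x = C i := rfl
    have f12 : D (e i) (D ((- lam i / 2) • e i) (D v (D v u))) x = (- lam i / 2) * B i := by
      rw [D_smul_dir2 ((hu.D v).D v), f9]
    have f13 : D ((- lam i / 2) • e i) (D v (D v u)) x = (- lam i / 2) * (lam i * s i) := by
      rw [D_smul_dir, f3]
    have f14 : D ((- lam i / 2) • e i) (D ((- lam i / 2) • e i) (D v u)) x
        = (- lam i / 2) ^ 2 * lam i := by
      rw [D_smul_dir, D_smul_dir2 (hu.D v), f5]; ring
    rw [f3, f4, f7, f8, f9, f10, f11, f12, f13, f14] at k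
    obtain ⟨k1, k2⟩ := k
    have hp := hΓ (e i)
    rw [f10] at hp
    set p := D (e i) u x
    set α := D (e i) (D v (D v (D v u))) x
    have k1' : ρ * (α + 3 * ((- lam i / 2) * (lam i * s i))) = p * a := by
      linear_combination k1
    have k2' := mul_le_mul_of_nonneg_left k2 hρ0.le
    have hpa : p ^ 2 * a ≤ Γ * 1 * a := mul_le_mul_of_nonneg_right hp ha.le
    have k3 : - a * ρ - 2 * (p ^ 2 * a) + ρ ^ 2 * (C i - 3 * lam i * B i + 3 / 2 * lam i ^ 3)
      - ρ ^ 2 * a * (3 / 2 * (B i - 3 / 2 * lam i ^ 2)) ≤ 0 := by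
      rw [mul_zero] at k2'
      refine le_of_eq_of_le ?_ k2'
      linear_combination (2 * p) * k1'
    linarith
  have hsum := Finset.sum_nonpos (s := Finset.univ) fun i _ => fl i
  have hsum2 : n * (- a * ρ - 2 * Γ * a) + ρ ^ 2 * ∑ i, lam i ^ 2 * (3 / 4 * a - 1 / 2 * lam i)
      ≤ 0 := by
    refine le_of_eq_of_le ?_ hsum
    have t2' : ∑ i, B i = ∑ i, lam i ^ 2 := t2
    have t3' : ∑ i, C i = 3 * ∑ i, lam i * B i - 2 * ∑ i, lam i ^ 3 := t3
    have e1 : ∀ i, - a * ρ - 2 * Γ * a + ρ ^ 2 * (C i - 3 * lam i * B i + 3 / 2 * lam i ^ 3)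
      - ρ ^ 2 * a * (3 / 2 * (B i - 3 / 2 * lam i ^ 2)) =
      (- a * ρ - 2 * Γ * a) + ρ ^ 2 * C i - 3 * ρ ^ 2 * (lam i * B i)
       + 3 / 2 * ρ ^ 2 * lam i ^ 3 - 3 / 2 * ρ ^ 2 * a * B i + 9 / 4 * ρ ^ 2 * a * lam i ^ 2 :=
      fun i => by ring
    have e2 : ∀ i, lam i ^ 2 * (3 / 4 * a - 1 / 2 * lam i) =
      3 / 4 * a * lam i ^ 2 - 1 / 2 * lam i ^ 3 := fun i => by ring
    simp only [e1, e2, Finset.sum_add_distrib, Finset.sum_sub_distrib, ← Finset.mul_sum, t2', t3',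
      Finset.sum_const, Finset.card_univ, Fintype.card_fin, nsmul_eq_mul]
    ring
  obtain ⟨l, hsl⟩ : ∃ l, s l ≠ 0 := by
    by_contra hc
    push Not at hc
    simp [hc] at hqs
  have hlal : lam l = a := mul_right_cancel₀ hsl (hls l)
  have hlow : a ^ 3 / 4 ≤ ∑ i, lam i ^ 2 * (3 / 4 * a - 1 / 2 * lam i) := by
    have := Finset.single_le_sum (f := fun i => lam i ^ 2 * (3 / 4 * a - 1 / 2 * lam i))
      (s := Finset.univ) (fun i _ => mul_nonneg (sq_nonneg _) (by linarith [hll i]))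
      (Finset.mem_univ l)
    simp only [hlal] at this
    linarith
  have h5 := mul_le_mul_of_nonneg_left hlow (sq_nonneg ρ)
  have h6 : a * (ρ ^ 2 * a ^ 2) ≤ a * (4 * n * ρ + 8 * n * Γ) := by linarith
  exact le_of_mul_le_mul_left h6 ha

end CPJ

namespace CPJ
variable {n : ℕ}

/-! ### Joint continuity -/

lemma joint_step {Φ : (Fin n → ℝ) → (Fin n → ℝ) → ℝ}
    (h : ContDiff ℝ (⊤ : ℕ∞) (fun p : (Fin n → ℝ) × (Fin n → ℝ) => Φ p.2 p.1)) :
    ContDiff ℝ (⊤ : ℕ∞) (fun p : (Fin n → ℝ) × (Fin n → ℝ) => D p.2 (Φ p.2) p.1) := by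
  unfold D
  have h1 : ContDiff ℝ (⊤ : ℕ∞)
      (fun p : (Fin n → ℝ) × (Fin n → ℝ) => fderiv ℝ (Φ p.2) p.1) := by
    apply ContDiff.fderiv (f := fun p : (Fin n → ℝ) × (Fin n → ℝ) => Φ p.2)
      (m := ((⊤ : ℕ∞) : WithTop ℕ∞))
    · exact h.comp (f := fun q : ((Fin n → ℝ) × (Fin n → ℝ)) × (Fin n → ℝ) => (q.2, q.1.2))
        (by fun_prop)
    · fun_prop
    · exact le_rfl
  exact h1.clm_apply contDiff_snd

lemma joint1 {u : (Fin n → ℝ) → ℝ} (hu : Sm u) :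
    ContDiff ℝ (⊤ : ℕ∞) (fun p : (Fin n → ℝ) × (Fin n → ℝ) => D p.2 u p.1) :=
  joint_step (Φ := fun _ => u) (ContDiff.comp hu contDiff_fst)

lemma joint2 {u : (Fin n → ℝ) → ℝ} (hu : Sm u) :
    ContDiff ℝ (⊤ : ℕ∞) (fun p : (Fin n → ℝ) × (Fin n → ℝ) => H u p.1 p.2 p.2) :=
  joint_step (Φ := fun v => D v u) (joint1 hu)

lemma joint3 {u : (Fin n → ℝ) → ℝ} (hu : Sm u) :
    ContDiff ℝ (⊤ : ℕ∞) (fun p : (Fin n → ℝ) × (Fin n → ℝ) => A3 u p.1 p.2) :=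
  joint_step (Φ := fun v => D v (D v u)) (joint2 hu)

lemma H_scale {u : (Fin n → ℝ) → ℝ} (hu : Sm u) (c : ℝ) (x v : Fin n → ℝ) :
    H u x (c • v) (c • v) = c ^ 2 * H u x v v := by
  unfold H
  rw [D_smul_dir2 hu, D_smul_dir]; ring

lemma A3_scale {u : (Fin n → ℝ) → ℝ} (hu : Sm u) (c : ℝ) (x v : Fin n → ℝ) :
    A3 u x (c • v) = c ^ 3 * A3 u x v := by
  have h := A3_curve hu c x 0 v
  simp only [zero_add] at h
  rw [h]
  have e : D (0 : Fin n → ℝ) u = fun _ => 0 := funext fun y => D_zero_dir u y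
  have e2 : ∀ w : Fin n → ℝ, D w (fun _ : Fin n → ℝ => (0:ℝ)) = fun _ => 0 := by
    intro w; funext y; simp [D]
  rw [e, e2, e2, e2, e2]
  simp [A3]

lemma H_pos {u : (Fin n → ℝ) → ℝ} (hu : Sm u) (hpos : ∀ x, (realHess n u x).PosDef)
    (x : Fin n → ℝ) {v : Fin n → ℝ} (hv : v ≠ 0) : 0 < H u x v v := by
  rw [H_eq_dot hu]
  simpa using (hpos x).dotProduct_mulVec_pos hv

lemma H_nonneg {u : (Fin n → ℝ) → ℝ} (hu : Sm u) (hpos : ∀ x, (realHess n u x).PosDef)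
    (x v : Fin n → ℝ) : 0 ≤ H u x v v := by
  by_cases hv : v = 0
  · subst hv; simp [H, D_zero_dir]
  · exact (H_pos hu hpos x hv).le

lemma hom_max (hn : 0 < n) {K : Set (Fin n → ℝ)} (hK : IsCompact K) (hK0 : K.Nonempty)
    (G : (Fin n → ℝ) → (Fin n → ℝ) → ℝ)
    (hG : ∀ x v, v ≠ 0 → ContinuousAt (fun p : (Fin n → ℝ) × (Fin n → ℝ) => G p.1 p.2) (x, v))
    (hom : ∀ x v (c : ℝ), 0 < c → v ≠ 0 → G x (c • v) = G x v) :
    ∃ x ∈ K, ∃ v, v ≠ 0 ∧ ∀ y ∈ K, ∀ w, w ≠ 0 → G y w ≤ G x v := by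
  have : Nonempty (Fin n) := ⟨⟨0, hn⟩⟩
  have hS : IsCompact (Metric.sphere (0 : Fin n → ℝ) 1) := isCompact_sphere _ _
  have hS0 : (Metric.sphere (0 : Fin n → ℝ) 1).Nonempty := by
    refine ⟨fun _ => 1, ?_⟩
    simp [pi_norm_const]
  have hne : ∀ v ∈ Metric.sphere (0 : Fin n → ℝ) 1, v ≠ 0 := by
    intro v hv h; subst h; simp at hv
  obtain ⟨⟨x, v⟩, hxv, hmax⟩ := (hK.prod hS).exists_isMaxOn (hK0.prod hS0)
    (f := fun p : (Fin n → ℝ) × (Fin n → ℝ) => G p.1 p.2)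
    (fun p hp => (hG p.1 p.2 (hne _ hp.2)).continuousWithinAt)
  refine ⟨x, hxv.1, v, hne _ hxv.2, ?_⟩
  intro y hy w hw
  have hw0 : 0 < ‖w‖ := norm_pos_iff.mpr hw
  rw [← hom y w (‖w‖⁻¹) (by positivity) hw]
  refine hmax (a := (y, ‖w‖⁻¹ • w)) ⟨hy, ?_⟩
  simp [norm_smul, hw0.ne']

/-! ### Coercivity -/

lemma taylor_convex {u : (Fin n → ℝ) → ℝ} (hu : Sm u) (hpos : ∀ x, (realHess n u x).PosDef)
    (h0 : u 0 = 0) (x : Fin n → ℝ) : ConvexOn ℝ Set.univ (fun t : ℝ => u (t • x)) := by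
  have d1 : ∀ t, HasDerivAt (fun t : ℝ => u (t • x)) (D x u (t • x)) t := by
    intro t; simpa using hasDerivAt_line hu 0 x t
  have d2 : ∀ t, HasDerivAt (fun t : ℝ => D x u (t • x)) (H u (t • x) x x) t := by
    intro t; simpa [H] using hasDerivAt_line (hu.D x) 0 x t
  have e1 : deriv (fun t : ℝ => u (t • x)) = fun t => D x u (t • x) :=
    funext fun t => (d1 t).deriv
  apply MonotoneOn.convexOn_of_deriv convex_univ
  · exact fun t _ => (d1 t).continuousAt.continuousWithinAt
  · exact fun t _ => (d1 t).differentiableAt.differentiableWithinAt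
  · rw [e1]
    apply Monotone.monotoneOn
    apply monotone_of_deriv_nonneg
    · exact fun t => (d2 t).differentiableAt
    · intro t; rw [(d2 t).deriv]; exact H_nonneg hu hpos _ _

lemma u_pos {u : (Fin n → ℝ) → ℝ} (hu : Sm u) (hpos : ∀ x, (realHess n u x).PosDef)
    (h0 : u 0 = 0) (h1 : ∀ v, D v u 0 = 0) {x : Fin n → ℝ} (hx : x ≠ 0) : 0 < u x := by
  have d1 : ∀ t, HasDerivAt (fun t : ℝ => u (t • x)) (D x u (t • x)) t := by
    intro t; simpa using hasDerivAt_line hu 0 x t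
  have d2 : ∀ t, HasDerivAt (fun t : ℝ => D x u (t • x)) (H u (t • x) x x) t := by
    intro t; simpa [H] using hasDerivAt_line (hu.D x) 0 x t
  have m : StrictMono (fun t : ℝ => D x u (t • x)) := by
    apply strictMono_of_deriv_pos
    intro t; rw [(d2 t).deriv]; exact H_pos hu hpos _ hx
  have m2 : StrictMonoOn (fun t : ℝ => u (t • x)) (Set.Icc 0 1) := by
    apply strictMonoOn_of_deriv_pos (convex_Icc 0 1)
    · exact fun t _ => (d1 t).continuousAt.continuousWithinAt
    · intro t ht
      rw [interior_Icc] at ht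
      rw [(d1 t).deriv]
      have := m ht.1
      simpa [h1] using this
  have := m2 (by simp) (by simp) (zero_lt_one)
  simpa [h0] using this

lemma u_nonneg {u : (Fin n → ℝ) → ℝ} (hu : Sm u) (hpos : ∀ x, (realHess n u x).PosDef)
    (h0 : u 0 = 0) (h1 : ∀ v, D v u 0 = 0) (x : Fin n → ℝ) : 0 ≤ u x := by
  by_cases hx : x = 0
  · rw [hx, h0]
  · exact (u_pos hu hpos h0 h1 hx).le

lemma compact_sub (hn : 0 < n) {u : (Fin n → ℝ) → ℝ} (hu : Sm u)
    (hpos : ∀ x, (realHess n u x).PosDef)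
    (h0 : u 0 = 0) (h1 : ∀ v, D v u 0 = 0) (M : ℝ) : IsCompact {x | u x ≤ M} := by
  have : Nonempty (Fin n) := ⟨⟨0, hn⟩⟩
  have hS : IsCompact (Metric.sphere (0 : Fin n → ℝ) 1) := isCompact_sphere _ _
  have hS0 : (Metric.sphere (0 : Fin n → ℝ) 1).Nonempty := by
    refine ⟨fun _ => 1, ?_⟩
    simp [pi_norm_const]
  obtain ⟨s, hs, hmin⟩ := hS.exists_isMinOn hS0 hu.cont.continuousOn
  have hs0 : s ≠ 0 := by intro h; subst h; simp at hs
  have hδ := u_pos hu hpos h0 h1 hs0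
  apply Metric.isCompact_of_isClosed_isBounded
  · exact isClosed_le hu.cont continuous_const
  · apply (Metric.isBounded_closedBall (x := (0 : Fin n → ℝ)) (r := max 1 (M / u s))).subset
    intro x hx
    simp only [Set.mem_ofPred_eq] at hx
    rw [mem_closedBall_zero_iff, le_max_iff]
    by_cases h : ‖x‖ ≤ 1
    · exact Or.inl h
    right
    push Not at h
    have hp : 0 < ‖x‖ := by linarith
    have hc := (taylor_convex hu hpos h0 (‖x‖⁻¹ • x)).2 (Set.mem_univ (0 : ℝ)) (Set.mem_univ ‖x‖)
      (show 0 ≤ 1 - ‖x‖⁻¹ by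
        have := inv_le_one_of_one_le₀ h.le; linarith) (show 0 ≤ ‖x‖⁻¹ by positivity) (by ring)
    have e : ‖x‖ • ‖x‖⁻¹ • x = x := by rw [smul_smul, mul_inv_cancel₀ hp.ne', one_smul]
    simp only [smul_eq_mul, mul_zero, zero_add, zero_smul, h0, e, inv_mul_cancel₀ hp.ne',
      one_smul] at hc
    have hm : u s ≤ u (‖x‖⁻¹ • x) := hmin (a := ‖x‖⁻¹ • x) (by simp [norm_smul, hp.ne'])
    rw [le_div_iff₀ hδ]
    have : u s * ‖x‖ ≤ (‖x‖⁻¹ * u x) * ‖x‖ := by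
      apply mul_le_mul_of_nonneg_right (hm.trans hc) hp.le
    have e3 : (‖x‖⁻¹ * u x) * ‖x‖ = u x := by field_simp
    linarith

/-! ### Gradient and cubic estimates -/

lemma grad_est (hn : 0 < n) {u : (Fin n → ℝ) → ℝ} (hu : Sm u)
    (hpos : ∀ x, (realHess n u x).PosDef) (hdet : ∀ x, (realHess n u x).det = 1)
    (h0 : u 0 = 0) (h1 : ∀ v, D v u 0 = 0) {M : ℝ} (hM : 0 < M) (x v : Fin n → ℝ)
    (hx : u x ≤ M) :
    (M - u x) ^ (2 * n) * (D v u x) ^ 2 ≤ (n + 8) * M ^ (2 * n + 1) * H u x v v := by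
  by_cases hv : v = 0
  · subst hv; simp [H, D_zero_dir]
  obtain ⟨x0, hx0, v0, hv0, hmax⟩ := hom_max hn (compact_sub hn hu hpos h0 h1 M)
    ⟨x, hx⟩ (fun x v => (M - u x) ^ (2 * n) * (D v u x) ^ 2 / H u x v v)
    (by
      intro y w hw
      apply ContinuousAt.div
      · apply Continuous.continuousAt
        have a := hu.cont
        have b := (joint1 hu).continuous
        fun_prop
      · exact (joint2 hu).continuous.continuousAt
      · exact (H_pos hu hpos y hw).ne')
    (by
      intro y w c hc hw
      have := (H_pos hu hpos y hw).ne'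
      simp only [H_scale hu, D_smul_dir]
      field_simp)
  simp only [Set.mem_ofPred_eq] at hx0 hmax
  have hv' := H_pos hu hpos x hv
  have hh0 := H_pos hu hpos x0 hv0
  suffices hm : (M - u x0) ^ (2 * n) * (D v0 u x0) ^ 2 / H u x0 v0 v0 ≤ (n + 8) * M ^ (2 * n + 1) by
    have := (hmax x hx v hv).trans hm
    rwa [div_le_iff₀ hv'] at this
  by_cases hD : D v0 u x0 = 0
  · rw [hD]; simp; positivity
  by_cases hlt : u x0 = M
  · rw [hlt]; simp [hn.ne']; positivity
  have hlt' : u x0 < M := lt_of_le_of_ne hx0 hlt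
  have hD2 : 0 < (D v0 u x0) ^ 2 := by positivity
  have key := grad_max hn hu hpos hdet x0 ((D v0 u x0 / H u x0 v0 v0) • v0) M
    ((D v0 u x0) ^ 2 / H u x0 v0 v0) hlt' (by positivity)
    (by rw [D_smul_dir]; ring) (by rw [H_scale hu]; field_simp)
    (by
      intro y hy w
      rw [← mul_div_assoc]
      by_cases hw : w = 0
      · subst hw
        simp only [H, D_zero_dir]
        have : 0 < M - u x0 := by linarith
        have h3 : 0 ≤ (M - u x0) ^ (2 * n) * D v0 u x0 ^ 2 / H u x0 v0 v0 := by positivity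
        simpa [H] using h3
      · refine le_trans ?_ (hmax y hy.le w hw)
        rw [mul_div_assoc]
        have hp := H_pos hu hpos y hw
        have : 0 ≤ M - u y := by linarith
        apply mul_le_mul_of_nonneg_left _ (by positivity)
        rw [le_div_iff₀ hp]
        nlinarith [sq_nonneg (D w u y - H u y w w)])
  have hρ : 0 < M - u x0 := by linarith
  have hρM : M - u x0 ≤ M := by linarith [u_nonneg hu hpos h0 h1 x0]
  rw [mul_div_assoc]
  calc (M - u x0) ^ (2 * n) * (D v0 u x0 ^ 2 / H u x0 v0 v0)
      ≤ (M - u x0) ^ (2 * n) * ((n + 8) * (M - u x0)) := by gcongr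
    _ = (n + 8) * (M - u x0) ^ (2 * n + 1) := by ring
    _ ≤ (n + 8) * M ^ (2 * n + 1) := by gcongr

lemma grad_est2 (hn : 0 < n) {u : (Fin n → ℝ) → ℝ} (hu : Sm u)
    (hpos : ∀ x, (realHess n u x).PosDef) (hdet : ∀ x, (realHess n u x).det = 1)
    (h0 : u 0 = 0) (h1 : ∀ v, D v u 0 = 0) {M : ℝ} (hM : 0 < M) (x v : Fin n → ℝ)
    (hx : u x ≤ M) :
    (D v u x) ^ 2 ≤ ((n + 8) * 2 ^ (2 * n + 1) * M) * H u x v v := by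
  have h := grad_est hn hu hpos hdet h0 h1 (M := 2 * M) (by linarith) x v (by linarith)
  have h2 : M ^ (2 * n) * (D v u x) ^ 2 ≤ (2 * M - u x) ^ (2 * n) * (D v u x) ^ 2 := by
    gcongr; linarith
  have h3 := h2.trans h
  have h4 : M ^ (2 * n) * (D v u x) ^ 2 ≤
      M ^ (2 * n) * (((n + 8) * 2 ^ (2 * n + 1) * M) * H u x v v) := by
    refine h3.trans (le_of_eq ?_)
    rw [mul_pow]; ring
  exact le_of_mul_le_mul_left h4 (by positivity)

lemma cubic_est (hn : 0 < n) {u : (Fin n → ℝ) → ℝ} (hu : Sm u)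
    (hpos : ∀ x, (realHess n u x).PosDef) (hdet : ∀ x, (realHess n u x).det = 1)
    (h0 : u 0 = 0) (h1 : ∀ v, D v u 0 = 0) {M : ℝ} (hM : 0 < M) (x v : Fin n → ℝ)
    (hx : u x ≤ M) (hv : H u x v v = 1) :
    (M - u x) * A3 u x v ≤
      Real.sqrt ((4 * n + 8 * n * ((n + 8) * 2 ^ (2 * n + 1))) * M) := by
  have hv00 : v ≠ 0 := by
    intro h; subst h; simp [H, D_zero_dir] at hv
  obtain ⟨x0, hx0, v0, hv0, hmax⟩ := hom_max hn (compact_sub hn hu hpos h0 h1 M)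
    ⟨x, hx⟩ (fun x v => (M - u x) * A3 u x v / (H u x v v * Real.sqrt (H u x v v)))
    (by
      intro y w hw
      have b := (joint2 hu).continuous
      apply ContinuousAt.div
      · apply Continuous.continuousAt
        have a := hu.cont
        have b := (joint3 hu).continuous
        fun_prop
      · apply Continuous.continuousAt
        exact b.mul b.sqrt
      · have := (H_pos hu hpos y hw)
        positivity)
    (by
      intro y w c hc hw
      have h := (H_pos hu hpos y hw)
      simp only [H_scale hu, A3_scale hu]
      rw [Real.sqrt_mul (by positivity), Real.sqrt_sq hc.le]
      have := (Real.sqrt_pos.mpr h).ne'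
      field_simp)
  simp only [Set.mem_ofPred_eq] at hx0 hmax
  have hh0 := H_pos hu hpos x0 hv0
  have hr0 := Real.sqrt_pos.mpr hh0
  have hrs := Real.mul_self_sqrt hh0.le
  obtain ⟨r, hr⟩ : ∃ r, r = Real.sqrt (H u x0 v0 v0) := ⟨_, rfl⟩
  rw [← hr] at hr0 hrs
  -- normalised vector
  have hv1 : H u x0 (r⁻¹ • v0) (r⁻¹ • v0) = 1 := by
    rw [H_scale hu, ← hrs]; field_simp
  have ha : A3 u x0 (r⁻¹ • v0) = A3 u x0 v0 / (H u x0 v0 v0 * Real.sqrt (H u x0 v0 v0)) := by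
    rw [A3_scale hu, ← hr, ← hrs]; field_simp
  have hle := hmax x hx v hv00
  rw [hv] at hle
  simp only [Real.sqrt_one, mul_one, div_one] at hle
  rw [mul_div_assoc, ← ha] at hle
  refine hle.trans ?_
  by_cases hlt : u x0 = M
  · rw [hlt]; simp
  have hlt' : u x0 < M := lt_of_le_of_ne hx0 hlt
  have hρ : 0 < M - u x0 := by linarith
  by_cases hap : A3 u x0 (r⁻¹ • v0) ≤ 0
  · exact (mul_nonpos_of_nonneg_of_nonpos hρ.le hap).trans (Real.sqrt_nonneg _)
  push Not at hap
  have key := cubic_max hu hpos hdet x0 (r⁻¹ • v0) M (A3 u x0 (r⁻¹ • v0))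
    ((n + 8) * 2 ^ (2 * n + 1) * M) hlt' hap rfl hv1
    (fun e => grad_est2 hn hu hpos hdet h0 h1 hM x0 e hx0)
    (by
      intro y hy w
      by_cases hw : w = 0
      · subst hw
        have e : A3 u y 0 = 0 := by simp [A3, D_zero_dir]
        simp [H, D_zero_dir, e]
      · have hp := H_pos hu hpos y hw
        have hs := Real.sqrt_pos.mpr hp
        have hss := Real.mul_self_sqrt hp.le
        have hm := hmax y hy.le w hw
        rw [mul_div_assoc (M - u x0), ← ha, div_le_iff₀ (by positivity)] at hm
        refine hm.trans ?_
        apply mul_le_mul_of_nonneg_left _ (by positivity)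
        obtain ⟨s, hs'⟩ : ∃ s, s = Real.sqrt (H u y w w) := ⟨_, rfl⟩
        rw [← hs'] at hs hss ⊢
        rw [← hss]
        nlinarith [mul_nonneg (sq_nonneg s) (sq_nonneg (s - 1))])
  apply Real.le_sqrt_of_sq_le
  rw [mul_pow]
  refine key.trans ?_
  have hρM : M - u x0 ≤ M := by linarith [u_nonneg hu hpos h0 h1 x0]
  have : 4 * (n:ℝ) * (M - u x0) ≤ 4 * n * M := by gcongr
  nlinarith

lemma A3_nonpos (hn : 0 < n) {u : (Fin n → ℝ) → ℝ} (hu : Sm u)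
    (hpos : ∀ x, (realHess n u x).PosDef) (hdet : ∀ x, (realHess n u x).det = 1)
    (h0 : u 0 = 0) (h1 : ∀ v, D v u 0 = 0) (x v : Fin n → ℝ) (hv : H u x v v = 1) :
    A3 u x v ≤ 0 := by
  by_contra hc
  push Not at hc
  obtain ⟨C, hC⟩ : ∃ C : ℝ, C = 4 * n + 8 * n * ((n + 8) * 2 ^ (2 * n + 1)) := ⟨_, rfl⟩
  have hC0 : 0 ≤ C := by rw [hC]; positivity
  have hu0 := u_nonneg hu hpos h0 h1 x
  -- choose `M` large
  obtain ⟨a, hadef⟩ : ∃ a, a = A3 u x v := ⟨_, rfl⟩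
  rw [← hadef] at hc
  obtain ⟨M, hM⟩ : ∃ M, M = 2 * u x + 1 + 4 * C / a ^ 2 := ⟨_, rfl⟩
  have hq : 0 ≤ 4 * C / a ^ 2 := by positivity
  have hMp : 0 < M := by linarith
  have h := cubic_est hn hu hpos hdet h0 h1 hMp x v (by linarith) hv
  rw [← hC, ← hadef] at h
  have h2 : M / 2 * a ≤ Real.sqrt (C * M) := by
    refine le_trans ?_ h
    apply mul_le_mul_of_nonneg_right _ hc.le
    linarith
  have h3 : (M / 2 * a) ^ 2 ≤ C * M := by
    have := pow_le_pow_left₀ (by positivity) h2 2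
    rwa [Real.sq_sqrt (by positivity)] at this
  have h4 : M * (M * a ^ 2) ≤ M * (4 * C) := by nlinarith
  have h5 := le_of_mul_le_mul_left h4 hMp
  have h6 : 4 * C / a ^ 2 * a ^ 2 = 4 * C := by field_simp
  have h7 : M * a ^ 2 = (2 * u x + 1) * a ^ 2 + 4 * C := by rw [hM, add_mul, h6]
  have : 0 < (2 * u x + 1) * a ^ 2 := by positivity
  linarith

lemma A3_zero (hn : 0 < n) {u : (Fin n → ℝ) → ℝ} (hu : Sm u)
    (hpos : ∀ x, (realHess n u x).PosDef) (hdet : ∀ x, (realHess n u x).det = 1)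
    (h0 : u 0 = 0) (h1 : ∀ v, D v u 0 = 0) (x v : Fin n → ℝ) :
    A3 u x v = 0 := by
  by_cases hv : v = 0
  · subst hv; simp [A3, D_zero_dir]
  have hh := H_pos hu hpos x hv
  obtain ⟨r, hr⟩ : ∃ r, r = Real.sqrt (H u x v v) := ⟨_, rfl⟩
  have hr0 := Real.sqrt_pos.mpr hh
  have hrs := Real.mul_self_sqrt hh.le
  rw [← hr] at hr0 hrs
  have a1 := A3_nonpos hn hu hpos hdet h0 h1 x (r⁻¹ • v) (by
    rw [H_scale hu, ← hrs]; field_simp)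
  have a2 := A3_nonpos hn hu hpos hdet h0 h1 x ((-r⁻¹) • v) (by
    rw [H_scale hu, ← hrs]; field_simp)
  rw [A3_scale hu] at a1 a2
  have h3 : (-r⁻¹) ^ 3 = - (r⁻¹ ^ 3) := by ring
  rw [h3] at a2
  have h4 : r⁻¹ ^ 3 * A3 u x v = 0 := by linarith
  rcases mul_eq_zero.mp h4 with h | h
  · have : 0 < r⁻¹ ^ 3 := by positivity
    linarith
  · exact h

lemma taylor2 {u : (Fin n → ℝ) → ℝ} (hu : Sm u) (h3 : ∀ x v, A3 u x v = 0) (x : Fin n → ℝ) :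
    u x = u 0 + D x u 0 + H u 0 x x / 2 := by
  have d1 : ∀ t, HasDerivAt (fun t : ℝ => u (t • x)) (D x u (t • x)) t := by
    intro t; simpa using hasDerivAt_line hu 0 x t
  have d2 : ∀ t, HasDerivAt (fun t : ℝ => D x u (t • x)) (H u (t • x) x x) t := by
    intro t; simpa [H] using hasDerivAt_line (hu.D x) 0 x t
  have d3 : ∀ t, HasDerivAt (fun t : ℝ => H u (t • x) x x) 0 t := by
    intro t
    have := hasDerivAt_line ((hu.D x).D x) 0 x t
    have e := h3 (0 + t • x) x
    unfold A3 at e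
    rw [e] at this
    simpa [H] using this
  have c3 : ∀ t : ℝ, H u (t • x) x x = H u 0 x x := by
    intro t
    have := is_const_of_deriv_eq_zero (fun t => (d3 t).differentiableAt) (fun t => (d3 t).deriv) t 0
    simpa using this
  have c2 : ∀ t : ℝ, D x u (t • x) - t * H u 0 x x = D x u 0 := by
    intro t
    have dd : ∀ t, HasDerivAt (fun t : ℝ => D x u (t • x) - t * H u 0 x x) 0 t := by
      intro t
      have := (d2 t).sub ((hasDerivAt_id t).mul_const (H u 0 x x))
      rw [c3] at this
      refine this.congr_deriv ?_
      simp
    have := is_const_of_deriv_eq_zero (fun t => (dd t).differentiableAt) (fun t => (dd t).deriv) t 0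
    simpa using this
  have dd : ∀ t, HasDerivAt
      (fun t : ℝ => u (t • x) - t * D x u 0 - t ^ 2 * (H u 0 x x / 2)) 0 t := by
    intro t
    have h := ((d1 t).sub ((hasDerivAt_id t).mul_const (D x u 0))).sub
      ((hasDerivAt_pow 2 t).mul_const (H u 0 x x / 2))
    refine h.congr_deriv ?_
    have := c2 t
    push_cast
    simp only [pow_one, one_mul]
    linarith
  have := is_const_of_deriv_eq_zero (fun t => (dd t).differentiableAt) (fun t => (dd t).deriv) 1 0
  simp at this
  linarith

lemma D_norm {u : (Fin n → ℝ) → ℝ} (hu : Sm u) (v : Fin n → ℝ) :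
    D v (fun x => u x - u 0 - fderiv ℝ u 0 x) = fun x => D v u x - D v u 0 := by
  funext x
  have h := ((hu.diff x).hasFDerivAt.sub_const (u 0)).sub (fderiv ℝ u 0).hasFDerivAt
  have h2 : HasFDerivAt (fun x => u x - u 0 - fderiv ℝ u 0 x) (fderiv ℝ u x - fderiv ℝ u 0) x := h
  unfold D
  rw [h2.fderiv]; rfl

lemma D_sub_const (f : (Fin n → ℝ) → ℝ) (c : ℝ) (v : Fin n → ℝ) :
    D v (fun x => f x - c) = D v f := by
  funext x; unfold D; rw [fderiv_sub_const]

lemma A3_all (hn : 0 < n) {u : (Fin n → ℝ) → ℝ} (hu : Sm u)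
    (hpos : ∀ x, (realHess n u x).PosDef) (hdet : ∀ x, (realHess n u x).det = 1)
    (x v : Fin n → ℝ) : A3 u x v = 0 := by
  have hw : Sm (fun x => u x - u 0 - fderiv ℝ u 0 x) := by
    unfold Sm at *; fun_prop
  have hess : ∀ x, realHess n (fun x => u x - u 0 - fderiv ℝ u 0 x) x = realHess n u x := by
    intro x
    ext j k
    have := congrFun (congrArg (D (Pi.single j 1)) (D_norm hu (Pi.single k 1))) x
    rw [D_sub_const] at this
    exact this
  have := A3_zero hn hw (fun x => by rw [hess]; exact hpos x)
    (fun x => by rw [hess]; exact hdet x) (by simp)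
    (fun v => by rw [D_norm hu]; simp) x v
  unfold A3 at *
  rwa [D_norm hu, D_sub_const] at this

end CPJ

/-- Calabi–Pogorelov / Jörgens theorem (graph form): a smooth function
`u : ℝⁿ → ℝ` whose Hessian is positive definite everywhere and satisfies the
Monge–Ampère equation `det(Hess u) = 1` on all of `ℝⁿ` is a quadratic polynomial
`u(x) = ½·xᵀAx + bᵀx + c` with `A` positive definite symmetric of determinant `1`.
Equivalently, the graph of `u` is affinely congruent to the paraboloid
`x^{n+1} = Σ (xⁱ)²`, and in particular the Blaschke metric `Hess u` is flat. -/
theorem calabi_pogorelov_jorgens (n : ℕ) (u : (Fin n → ℝ) → ℝ)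
    (hu : ContDiff ℝ (⊤ : ℕ∞) u)
    (hpos : ∀ x : Fin n → ℝ, (realHess n u x).PosDef)
    (hdet : ∀ x : Fin n → ℝ, (realHess n u x).det = 1) :
    ∃ A : Matrix (Fin n) (Fin n) ℝ, ∃ b : Fin n → ℝ, ∃ c : ℝ,
      A.PosDef ∧ A.IsSymm ∧ A.det = 1 ∧
      ∀ x : Fin n → ℝ, u x = (1 / 2) * (x ⬝ᵥ A.mulVec x) + b ⬝ᵥ x + c := by
  have hs : CPJ.Sm u := hu
  refine ⟨realHess n u 0, fun k => CPJ.D (Pi.single k 1) u 0, u 0, hpos 0, ?_, hdet 0, ?_⟩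
  · ext j k
    exact CPJ.H_symm hs 0 (Pi.single k 1) (Pi.single j 1)
  · intro x
    have h3 : ∀ y v, CPJ.A3 u y v = 0 := by
      intro y v
      rcases Nat.eq_zero_or_pos n with hn | hn
      · subst hn
        have : v = 0 := Subsingleton.elim _ _
        subst this
        exact CPJ.D_zero_dir _ y
      · exact CPJ.A3_all hn hs hpos hdet y v
    have hT := CPJ.taylor2 hs h3 x
    have hD : CPJ.D x u 0 = (fun k => CPJ.D (Pi.single k 1) u 0) ⬝ᵥ x := by
      conv_lhs => rw [CPJ.pi_eq_sum_single x, CPJ.D_sum_dir]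
      simp only [CPJ.D_smul_dir, dotProduct]
      exact Finset.sum_congr rfl fun k _ => mul_comm _ _
    rw [hT, hD, CPJ.H_eq_dot hs]
    ring
end
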